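/- arXiv:1709.06965 — 4 statements merged into one kernel-verified Lean document; each statement's English description precedes it below -/
import Mathlib

section
/- For every n ≥ 1, every crossing-free circular-arc drawing of the complete graph K_n in ℝ³ covered by a family of r circles satisfies r ≥ ⌊n²/8⌋. -/
open Set

noncomputable section

/-- An `l`-dimensional sphere in `ℝ^d`: the set of points of an `(l+1)`-dimensional affine
subspace `P` of `ℝ^d` at a fixed positive distance `r` from a center `c ∈ P`. -/
def IsSphereDim (d l : ℕ) (S : Set (EuclideanSpace ℝ (Fin d))) : Prop :=
  ∃ (P : AffineSubspace ℝ (EuclideanSpace ℝ (Fin d))) (c : EuclideanSpace ℝ (Fin d)) (r : ℝ),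
    Module.finrank ℝ P.direction = l + 1 ∧ c ∈ P ∧ 0 < r ∧
    S = {x | x ∈ P ∧ dist x c = r}

/-- A circle in `ℝ^d` is a 1-dimensional sphere. -/
def IsCircle (d : ℕ) (S : Set (EuclideanSpace ℝ (Fin d))) : Prop :=
  IsSphereDim d 1 S

/-- An arc in `ℝ^d`: a nonempty compact connected subset of a circle. -/
def IsArc (d : ℕ) (A : Set (EuclideanSpace ℝ (Fin d))) : Prop :=
  ∃ C, IsCircle d C ∧ A ⊆ C ∧ IsCompact A ∧ IsConnected A

/-- A crossing-free circular-arc drawing of a simple graph `G` in `ℝ^d`: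
vertices are mapped injectively to points, every edge `e = uv` is represented by an arc
`arc e` containing the images of `u` and `v`, the arcs of two distinct edges intersect
exactly in the images of the common endpoints of those edges, and the image of a vertex `w`
lies on the arc of an edge `e` only if `w` is an endpoint of `e`. -/
structure CircularArcDrawing (d : ℕ) {V : Type*} (G : SimpleGraph V) where
  pos : V → EuclideanSpace ℝ (Fin d)
  inj : Function.Injective pos
  arc : Sym2 V → Set (EuclideanSpace ℝ (Fin d))
  arc_isArc : ∀ e ∈ G.edgeSet, IsArc d (arc e)
  endpoint_mem : ∀ e ∈ G.edgeSet, ∀ v ∈ e, pos v ∈ arc e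
  crossFree : ∀ e ∈ G.edgeSet, ∀ f ∈ G.edgeSet, e ≠ f →
    arc e ∩ arc f = pos '' {w | w ∈ e ∧ w ∈ f}
  vertex_mem : ∀ e ∈ G.edgeSet, ∀ w, pos w ∈ arc e → w ∈ e

/-- The drawing `D` is covered by the family `𝒞` of sets:
every arc of `D` is contained in some member of `𝒞`. -/
def CircularArcDrawing.CoveredBy {d : ℕ} {V : Type*} {G : SimpleGraph V}
    (D : CircularArcDrawing d G) (𝒞 : Finset (Set (EuclideanSpace ℝ (Fin d)))) : Prop :=
  ∀ e ∈ G.edgeSet, ∃ C ∈ 𝒞, D.arc e ⊆ C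

/-- A circle not contained in the plane `f = t` does not contain three points of that plane. -/
lemma circle_plane_aux {C : Set (EuclideanSpace ℝ (Fin 3))} (hC : IsCircle 3 C)
    (f : EuclideanSpace ℝ (Fin 3) →ₗ[ℝ] ℝ) (t : ℝ)
    {u x y z : EuclideanSpace ℝ (Fin 3)} (hu : u ∈ C) (hx : x ∈ C) (hy : y ∈ C) (hz : z ∈ C)
    (hfx : f x = t) (hfy : f y = t) (hfz : f z = t) (hfu : f u ≠ t)
    (hxy : x ≠ y) (hxz : x ≠ z) (hyz : y ≠ z) : False := by
  obtain ⟨P, c, r, hP, hc, hr, rfl⟩ := hC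
  have hcos : EuclideanGeometry.Cospherical {x | x ∈ P ∧ dist x c = r} := ⟨c, r, fun p hp => hp.2⟩
  have hind := hcos.affineIndependent_of_mem_of_ne hx hy hz hxy hxz hyz
  have hspan : affineSpan ℝ (Set.range ![x, y, z]) = P := by
    apply hind.affineSpan_eq_of_le_of_card_eq_finrank_add_one
    · apply affineSpan_le_of_subset_coe
      rintro _ ⟨i, rfl⟩
      fin_cases i
      · exact hx.1
      · exact hy.1
      · exact hz.1
    · simp [hP]
  have hle : affineSpan ℝ (Set.range ![x, y, z]) ≤ AffineSubspace.mk' x (LinearMap.ker f) := by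
    apply affineSpan_le_of_subset_coe
    rintro _ ⟨i, rfl⟩
    fin_cases i <;> simp [AffineSubspace.mem_mk', hfx, hfy, hfz]
  have h2 : u ∈ AffineSubspace.mk' x (LinearMap.ker f) := hle (hspan ▸ hu.1)
  simp only [AffineSubspace.mem_mk', vsub_eq_sub, LinearMap.mem_ker, map_sub, hfx] at h2
  exact hfu (by linarith)

/-- A finite injective family of reals can be split at any prescribed size. -/
lemma split_aux {n k : ℕ} (g : Fin n → ℝ) (hg : Function.Injective g) (hk : 0 < k) (hkn : k < n) :
    ∃ (t : ℝ) (a : Fin k → Fin n) (b : Fin (n - k) → Fin n), Function.Injective a ∧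
      Function.Injective b ∧ (∀ i, g (a i) < t) ∧ (∀ j, t < g (b j)) := by
  have hmono : StrictMono (g ∘ Tuple.sort g) :=
    (Tuple.monotone_sort g).strictMono_of_injective (hg.comp (Tuple.sort g).injective)
  set σ := Tuple.sort g
  have hlt : g (σ ⟨k - 1, by omega⟩) < g (σ ⟨k, hkn⟩) :=
    hmono (by simp only [Fin.mk_lt_mk]; omega)
  obtain ⟨t, ht1, ht2⟩ := exists_between hlt
  refine ⟨t, fun i => σ ⟨i, by omega⟩, fun j => σ ⟨k + j, by omega⟩, ?_, ?_, ?_, ?_⟩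
  · intro i j h
    have := σ.injective h
    simp only [Fin.mk.injEq] at this
    exact Fin.ext this
  · intro i j h
    have := σ.injective h
    simp only [Fin.mk.injEq] at this
    exact Fin.ext (by omega)
  · intro i
    refine lt_of_le_of_lt (hmono.monotone ?_) ht1
    simp only [Fin.mk_le_mk]; omega
  · intro j
    refine lt_of_lt_of_le ht2 (hmono.monotone ?_)
    simp only [Fin.mk_le_mk]; omega

/-- For every `n ≥ 1`, every crossing-free circular-arc drawing of the complete graph `K_n`
in `ℝ³` covered by a family of `r` circles satisfies `r ≥ ⌊n²/8⌋`. -/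
theorem completeGraph_circle_cover_lower_bound (n : ℕ) (hn : 1 ≤ n)
    (D : CircularArcDrawing 3 (⊤ : SimpleGraph (Fin n)))
    (𝒞 : Finset (Set (EuclideanSpace ℝ (Fin 3))))
    (hcirc : ∀ C ∈ 𝒞, IsCircle 3 C) (hcov : D.CoveredBy 𝒞)
    (r : ℕ) (hr : 𝒞.card = r) :
    n ^ 2 / 8 ≤ r := by
  classical
  subst hr
  rcases Nat.lt_or_ge n 2 with h2 | h2
  · have : n = 1 := by omega
    subst this; simp
  -- a generic linear functional
  obtain ⟨f, hf⟩ := Module.exists_dual_forall_apply_ne_zero (K := ℝ)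
    (fun p : {p : Fin n × Fin n // p.1 ≠ p.2} => D.pos p.1.1 - D.pos p.1.2)
    (fun p => sub_ne_zero.2 (fun h => p.2 (D.inj h)))
  have hg : Function.Injective (fun i => f (D.pos i)) := by
    intro i j hij
    by_contra hne
    apply hf ⟨(i, j), hne⟩
    simp only [map_sub]
    exact sub_eq_zero.2 hij
  have hcont : Continuous f := LinearMap.continuous_of_finiteDimensional f
  obtain ⟨t, a, b, ha, hb, hat, hbt⟩ := split_aux (k := n / 2) _ hg (by omega) (by omega)
  have hab : ∀ i j, a i ≠ b j := fun i j h => by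
    have h1 := hat i; have h2 := hbt j; rw [h] at h1; linarith
  have hedge : ∀ p : Fin (n / 2) × Fin (n - n / 2),
      s(a p.1, b p.2) ∈ (⊤ : SimpleGraph (Fin n)).edgeSet := fun p => by
    simpa using hab p.1 p.2
  -- crossing points with the plane
  have hpt : ∀ p : Fin (n / 2) × Fin (n - n / 2), ∃ x ∈ D.arc s(a p.1, b p.2), f x = t := by
    intro p
    obtain ⟨C, -, -, -, hconn⟩ := D.arc_isArc _ (hedge p)
    have h1 := D.endpoint_mem _ (hedge p) (a p.1) (by simp)
    have h2 := D.endpoint_mem _ (hedge p) (b p.2) (by simp)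
    exact hconn.isPreconnected.intermediate_value h1 h2 hcont.continuousOn
      ⟨(hat p.1).le, (hbt p.2).le⟩
  choose q hq hqt using hpt
  choose c hc hcs using fun p => hcov _ (hedge p)
  have hqinj : Function.Injective q := by
    intro p p' h
    by_contra hne
    have hee : s(a p.1, b p.2) ≠ s(a p'.1, b p'.2) := by
      intro he
      rw [Sym2.eq_iff] at he
      rcases he with ⟨h1, h2⟩ | ⟨h1, -⟩
      · exact hne (Prod.ext (ha h1) (hb h2))
      · exact hab _ _ h1
    have hmem : q p ∈ D.arc s(a p.1, b p.2) ∩ D.arc s(a p'.1, b p'.2) := ⟨hq p, h ▸ hq p'⟩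
    rw [D.crossFree _ (hedge p) _ (hedge p') hee] at hmem
    obtain ⟨w, ⟨hw, -⟩, hwq⟩ := hmem
    have htt := hqt p
    rw [← hwq] at htt
    rcases Sym2.mem_iff.1 hw with rfl | rfl
    · exact (hat p.1).ne htt
    · exact (hbt p.2).ne' htt
  have hcard := Finset.card_le_mul_card_image_of_maps_to (s := Finset.univ) (t := 𝒞) (f := c)
    (fun p _ => hc p) 2 (by
      intro C hC
      by_contra! hlt
      obtain ⟨x, y, z, hx, hy, hz, hxy, hxz, hyz⟩ := Finset.two_lt_card_iff.1 hlt
      simp only [Finset.mem_filter, Finset.mem_univ, true_and] at hx hy hz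
      refine circle_plane_aux (hcirc C hC) f t (u := D.pos (a x.1)) (x := q x) (y := q y)
        (z := q z) ?_ ?_ ?_ ?_ (hqt x) (hqt y) (hqt z) (hat x.1).ne
        (hqinj.ne hxy) (hqinj.ne hxz) (hqinj.ne hyz)
      · exact hx ▸ hcs x (D.endpoint_mem _ (hedge x) (a x.1) (by simp))
      · exact hx ▸ hcs x (hq x)
      · exact hy ▸ hcs y (hq y)
      · exact hz ▸ hcs z (hq z))
  simp only [Finset.card_univ, Fintype.card_prod, Fintype.card_fin] at hcard
  have key : n ^ 2 ≤ 4 * (n / 2 * (n - n / 2)) + 1 := by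
    rcases Nat.even_or_odd' n with ⟨m, rfl | rfl⟩
    · have h1 : 2 * m / 2 = m := by omega
      have h3 : 2 * m - m = m := by omega
      rw [h1, h3]; nlinarith
    · have h1 : (2 * m + 1) / 2 = m := by omega
      have h3 : 2 * m + 1 - m = m + 1 := by omega
      rw [h1, h3]; nlinarith
  omega
end
end

section
/- For every n ≥ 1, the complete graph K_n admits a crossing-free circular-arc drawing in ℝ³ covered by a family of at most ⌊(n² + 5n + 6)/6⌋ circles. -/
open Set

noncomputable section

/-- Euclidean three-space. -/
abbrev E3 := EuclideanSpace ℝ (Fin 3)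

/-- The lift of a point to the paraboloid, in homogeneous coordinates. -/
def liftPt {R : Type*} [CommRing R] (x : Fin 3 → R) : Fin 5 → R :=
  ![1, x 0, x 1, x 2, x 0 ^ 2 + x 1 ^ 2 + x 2 ^ 2]

/-- Squared distance. -/
def sqd {R : Type*} [CommRing R] (x y : Fin 3 → R) : R :=
  (x 0 - y 0) ^ 2 + (x 1 - y 1) ^ 2 + (x 2 - y 2) ^ 2

/-- The matrix of lifts of five points. -/
def mat5 {R : Type*} [CommRing R] (q : Fin 5 → Fin 3 → R) : Matrix (Fin 5) (Fin 5) R :=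
  Matrix.of fun i => liftPt (q i)

/-- Cramer coefficients of the sixth point with respect to the first five. -/
def mu6 {R : Type*} [CommRing R] (q : Fin 6 → Fin 3 → R) : Fin 5 → R :=
  Matrix.vecMul (liftPt (q 5)) (mat5 (fun k => q k.castSucc)).adjugate

/-- The quadratic obstruction. -/
def quad3 {R : Type*} [CommRing R] (c0 c1 c2 : R) (x y z : Fin 3 → R) : R :=
  c0 * c1 * sqd x y + c0 * c2 * sqd x z + c1 * c2 * sqd y z

/-- The polynomial for six points. -/
def psi6 {R : Type*} [CommRing R] (q : Fin 6 → Fin 3 → R) : R :=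
  quad3 (mu6 q 0) (mu6 q 1) (mu6 q 2) (q 0) (q 1) (q 2)

theorem map_liftPt {R S : Type*} [CommRing R] [CommRing S] (g : R →+* S) (x : Fin 3 → R) :
    (fun j => g (liftPt x j)) = liftPt (fun j => g (x j)) := by
  funext j
  fin_cases j <;> simp [liftPt]

theorem map_mat5 {R S : Type*} [CommRing R] [CommRing S] (g : R →+* S) (q : Fin 5 → Fin 3 → R) :
    g.mapMatrix (mat5 q) = mat5 (fun i j => g (q i j)) := by
  ext i j
  exact congrFun (map_liftPt g (q i)) j

theorem map_mu6 {R S : Type*} [CommRing R] [CommRing S] (g : R →+* S) (q : Fin 6 → Fin 3 → R)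
    (k : Fin 5) : g (mu6 q k) = mu6 (fun i j => g (q i j)) k := by
  have h := RingHom.map_vecMul g (mat5 (fun k => q k.castSucc)).adjugate (liftPt (q 5)) k
  unfold mu6
  rw [h]
  have h2 := RingHom.map_adjugate g (mat5 (fun k => q k.castSucc))
  rw [map_mat5] at h2
  rw [← h2]
  congr 1
  exact map_liftPt g (q 5)

theorem map_psi6 {R S : Type*} [CommRing R] [CommRing S] (g : R →+* S) (q : Fin 6 → Fin 3 → R) :
    g (psi6 q) = psi6 (fun i j => g (q i j)) := by
  simp only [psi6, quad3, sqd, map_add, map_mul, map_mu6, map_pow, map_sub]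

theorem map_det5 {R S : Type*} [CommRing R] [CommRing S] (g : R →+* S) (q : Fin 5 → Fin 3 → R) :
    g (mat5 q).det = (mat5 (fun i j => g (q i j))).det := by
  rw [RingHom.map_det, map_mat5]

theorem map_det3 {R S : Type*} [CommRing R] [CommRing S] (g : R →+* S) (q : Fin 3 → Fin 3 → R) :
    g (Matrix.of q).det = (Matrix.of (fun i j => g (q i j))).det := by
  rw [RingHom.map_det]; rfl

/-- Witness configuration of six points. -/
def wit : Fin 6 → Fin 3 → ℝ :=
  ![![1, 0, 0], ![0, 1, 0], ![0, 0, 1], ![-1, 0, 0], ![0, 0, 0], ![1, 1, 1]]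

theorem wit_det5 : (mat5 (fun k : Fin 5 => wit k.castSucc)).det ≠ 0 := by
  intro h
  obtain ⟨v, hv, h0⟩ := Matrix.exists_vecMul_eq_zero_iff.mpr h
  apply hv
  have e : ∀ j, Matrix.vecMul v (mat5 (fun k : Fin 5 => wit k.castSucc)) j = 0 := fun j => by
    rw [h0]; rfl
  have e0 := e 0
  have e1 := e 1
  have e2 := e 2
  have e3 := e 3
  have e4 := e 4
  simp [Matrix.vecMul, dotProduct, mat5, liftPt, wit, Fin.sum_univ_succ] at e0 e1 e2 e3 e4
  funext j
  fin_cases j <;> simp <;> linarith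

theorem wit_psi6 : psi6 wit ≠ 0 := by
  have hmu : mu6 wit = (mat5 (fun k : Fin 5 => wit k.castSucc)).det • ![1, 1, 1, 0, -2] := by
    have : liftPt (wit 5) =
        Matrix.vecMul ![1, 1, 1, 0, -2] (mat5 (fun k : Fin 5 => wit k.castSucc)) := by
      funext j
      fin_cases j <;>
        simp [Matrix.vecMul, dotProduct, mat5, liftPt, wit, Fin.sum_univ_succ] <;> norm_num
    unfold mu6
    rw [this, Matrix.vecMul_vecMul, Matrix.mul_adjugate, Matrix.vecMul_smul, Matrix.vecMul_one]
  have hd := wit_det5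
  unfold psi6
  rw [hmu]
  generalize (mat5 (fun k : Fin 5 => wit k.castSucc)).det = D at hd
  simp [quad3, sqd, wit]
  intro h
  apply hd
  nlinarith

theorem wit_det3 : (Matrix.of (fun k : Fin 3 => wit (k.castLE (by norm_num)))).det ≠ 0 := by
  simp [Matrix.det_fin_three, wit]

theorem exists_common_nonzero {σ : Type*} {κ : Type*} [Fintype κ] (F : κ → MvPolynomial σ ℝ)
    (hF : ∀ k, F k ≠ 0) : ∃ v : σ → ℝ, ∀ k, MvPolynomial.eval v (F k) ≠ 0 := by
  have h : ∏ k, F k ≠ 0 := Finset.prod_ne_zero_iff.mpr fun k _ => hF k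
  by_contra hc
  push Not at hc
  apply h
  apply MvPolynomial.funext
  intro v
  obtain ⟨k, hk⟩ := hc v
  rw [map_prod, map_zero]
  exact Finset.prod_eq_zero (Finset.mem_univ k) hk

/-- Coordinates variables. -/
def vars {ι κ : Type*} (f : κ → ι) : κ → Fin 3 → MvPolynomial (ι × Fin 3) ℝ :=
  fun k j => MvPolynomial.X (f k, j)

theorem eval_vars {ι κ : Type*} (f : κ → ι) (v : ι × Fin 3 → ℝ) :
    (fun k j => MvPolynomial.eval v (vars f k j)) = fun k j => v (f k, j) := by
  funext k j
  simp [vars]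

theorem exists_pt {ι κ : Type*} (f : κ → ι) (hf : Function.Injective f) (w : κ → Fin 3 → ℝ) :
    ∃ v : ι × Fin 3 → ℝ, (fun k j => v (f k, j)) = w := by
  refine ⟨fun x => Function.extend f w 0 x.1 x.2, ?_⟩
  funext k j
  simp [hf.extend_apply]

theorem exists_generic_coords (ι : Type*) [Fintype ι] :
    ∃ v : ι × Fin 3 → ℝ,
      (∀ f : Fin 3 ↪ ι, (Matrix.of (fun k j => v (f k, j))).det ≠ 0) ∧
      (∀ f : Fin 5 ↪ ι, (mat5 (fun k j => v (f k, j))).det ≠ 0) ∧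
      (∀ f : Fin 6 ↪ ι, psi6 (fun k j => v (f k, j)) ≠ 0) := by
  classical
  obtain ⟨v, hv⟩ := exists_common_nonzero
    (κ := (Fin 3 ↪ ι) ⊕ (Fin 5 ↪ ι) ⊕ (Fin 6 ↪ ι)) (σ := ι × Fin 3)
    (Sum.elim (fun f => (Matrix.of (vars f)).det)
      (Sum.elim (fun f => (mat5 (vars f)).det) (fun f => psi6 (vars f)))) (by
      rintro (f | f | f) h
      · obtain ⟨v, hv⟩ := exists_pt f f.injective (fun k => wit (k.castLE (by norm_num)))
        apply wit_det3
        rw [← hv, ← eval_vars, ← map_det3]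
        simp only [Sum.elim_inl] at h
        rw [h, map_zero]
      · obtain ⟨v, hv⟩ := exists_pt f f.injective (fun k => wit k.castSucc)
        apply wit_det5
        rw [← hv, ← eval_vars, ← map_det5]
        simp only [Sum.elim_inl, Sum.elim_inr] at h
        rw [h, map_zero]
      · obtain ⟨v, hv⟩ := exists_pt f f.injective wit
        apply wit_psi6
        rw [← hv, ← eval_vars, ← map_psi6]
        simp only [Sum.elim_inr] at h
        rw [h, map_zero])
  refine ⟨v, fun f => ?_, fun f => ?_, fun f => ?_⟩
  · have := hv (Sum.inl f)
    simpa only [Sum.elim_inl, map_det3, eval_vars] using this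
  · have := hv (Sum.inr (Sum.inl f))
    simpa only [Sum.elim_inl, Sum.elim_inr, map_det5, eval_vars] using this
  · have := hv (Sum.inr (Sum.inr f))
    simpa only [Sum.elim_inr, map_psi6, eval_vars] using this

/-- Points in general position. -/
structure Generic {ι : Type*} [Fintype ι] (p : ι → E3) : Prop where
  g1 : ∀ u v w, u ≠ v → u ≠ w → v ≠ w → LinearIndependent ℝ ![p u, p v, p w]
  g2 : ∀ f : Fin 5 ↪ ι, ∀ c : Fin 5 → ℝ, ∑ k, c k = 0 → ∑ k, c k • p (f k) = 0 →
    ∑ k, c k * ‖p (f k)‖ ^ 2 = 0 → c = 0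
  g3 : ∀ f : Fin 6 ↪ ι, ∀ c : Fin 6 → ℝ, ∑ k, c k = 0 → ∑ k, c k • p (f k) = 0 →
    ∑ k, c k * ‖p (f k)‖ ^ 2 = 0 →
    quad3 (c 0) (c 1) (c 2) (p (f 0)) (p (f 1)) (p (f 2)) = 0 → c = 0

theorem vecMul_lift {m : ℕ} (c : Fin m → ℝ) (q : Fin m → E3) (h0 : ∑ k, c k = 0)
    (h1 : ∑ k, c k • q k = 0) (h2 : ∑ k, c k * ‖q k‖ ^ 2 = 0) :
    ∀ j, ∑ k, c k * liftPt (q k) j = 0 := by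
  have e : ∀ i : Fin 3, ∑ k, c k * q k i = 0 := fun i => by
    have := congrArg (fun x : E3 => x i) h1
    simpa using this
  intro j
  fin_cases j
  · simpa [liftPt] using h0
  · simpa [liftPt] using e 0
  · simpa [liftPt] using e 1
  · simpa [liftPt] using e 2
  · simpa [liftPt, EuclideanSpace.real_norm_sq_eq, Fin.sum_univ_three] using h2

theorem exists_generic (ι : Type*) [Fintype ι] : ∃ p : ι → E3, Generic p := by
  obtain ⟨v, h3, h5, h6⟩ := exists_generic_coords ι
  have g2 : ∀ f : Fin 5 ↪ ι, ∀ c : Fin 5 → ℝ, ∑ k, c k = 0 →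
    ∑ k, c k • (WithLp.toLp 2 (fun j => v (f k, j)) : E3) = 0 →
    ∑ k, c k * ‖(WithLp.toLp 2 (fun j => v (f k, j)) : E3)‖ ^ 2 = 0 → c = 0 := by
    intro f c h0 h1 h2
    have h := vecMul_lift c _ h0 h1 h2
    exact Matrix.eq_zero_of_vecMul_eq_zero (h5 f) (funext h)
  refine ⟨fun i => WithLp.toLp 2 (fun j => v (i, j)), ?_, g2, ?_⟩
  · intro u x w h1 h2 h4
    have hinj : Function.Injective ![u, x, w] := by
      intro i j
      fin_cases i <;> fin_cases j <;> simp [h1, h2, h4, h1.symm, h2.symm, h4.symm]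
    have hd := h3 ⟨![u, x, w], hinj⟩
    have := Matrix.linearIndependent_rows_of_det_ne_zero hd
    have h' := this.map' (WithLp.linearEquiv 2 ℝ (Fin 3 → ℝ)).symm.toLinearMap
      (LinearEquiv.ker _)
    have h9 : ![(WithLp.toLp 2 (fun j => v (u, j)) : E3), WithLp.toLp 2 (fun j => v (x, j)),
        WithLp.toLp 2 (fun j => v (w, j))] = (WithLp.linearEquiv 2 ℝ (Fin 3 → ℝ)).symm.toLinearMap ∘
        fun i => Matrix.of (fun k j => v (![u, x, w] k, j)) i := by
      funext i
      fin_cases i <;> rfl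
    rw [h9]
    exact h'
  · intro f c h0 h1 h2 hq
    have h : ∀ j, ∑ k, c k * liftPt (fun j => v (f k, j)) j = 0 := vecMul_lift c _ h0 h1 h2
    set M := mat5 (fun (k : Fin 5) j => v (f k.castSucc, j)) with hM
    set q : Fin 6 → Fin 3 → ℝ := fun k j => v (f k, j) with hqdef
    have hD : M.det ≠ 0 := by
      have := h5 ((⟨Fin.castSucc, Fin.castSucc_injective 5⟩ : Fin 5 ↪ Fin 6).trans f)
      exact this
    have hP : psi6 q ≠ 0 := h6 f
    have e1 : Matrix.vecMul (fun k : Fin 5 => c k.castSucc) M = (-c 5) • liftPt (q 5) := by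
      funext j
      have := h j
      rw [Fin.sum_univ_castSucc] at this
      have h7 : Matrix.vecMul (fun k : Fin 5 => c k.castSucc) M j
        = ∑ k : Fin 5, c k.castSucc * liftPt (q k.castSucc) j := rfl
      rw [h7]
      have h8 : ∑ k : Fin 5, c k.castSucc * liftPt (q k.castSucc) j
        + c 5 * liftPt (q 5) j = 0 := this
      simp only [Pi.smul_apply, smul_eq_mul]
      linarith
    have e2 : M.det • (fun k : Fin 5 => c k.castSucc) = (-c 5) • mu6 q := by
      have := congrArg (fun x => Matrix.vecMul x M.adjugate) e1
      simp only [Matrix.vecMul_vecMul, Matrix.mul_adjugate, Matrix.vecMul_smul,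
        Matrix.vecMul_one, Matrix.smul_vecMul] at this
      exact this
    have e3 : ∀ k : Fin 5, M.det * c k.castSucc = -c 5 * mu6 q k := fun k => congrFun e2 k
    have k0 : M.det * c 0 = -c 5 * mu6 q 0 := e3 0
    have k1 : M.det * c 1 = -c 5 * mu6 q 1 := e3 1
    have k2 : M.det * c 2 = -c 5 * mu6 q 2 := e3 2
    have e4 : c 5 ^ 2 * psi6 q = 0 := by
      have hq' : quad3 (c 0) (c 1) (c 2) (q 0) (q 1) (q 2) = 0 := hq
      have : M.det ^ 2 * quad3 (c 0) (c 1) (c 2) (q 0) (q 1) (q 2) = c 5 ^ 2 * psi6 q := by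
        unfold psi6 quad3
        calc _ = (M.det * c 0) * (M.det * c 1) * sqd (q 0) (q 1)
              + (M.det * c 0) * (M.det * c 2) * sqd (q 0) (q 2)
              + (M.det * c 1) * (M.det * c 2) * sqd (q 1) (q 2) := by ring
          _ = _ := by rw [k0, k1, k2]; ring
      rw [← this, hq', mul_zero]
    have c5 : c 5 = 0 := by
      rcases mul_eq_zero.mp e4 with h | h
      · exact pow_eq_zero_iff (two_ne_zero) |>.mp h
      · exact absurd h hP
    funext k
    refine Fin.lastCases ?_ (fun k => ?_) k
    · exact c5
    · have := e3 k
      rw [c5] at this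
      simpa [hD] using this

/-- `α` are affine coefficients for `x` with respect to the points in `T`, compatible with the
squared norm, i.e. exhibiting `x` as a point of the circle through `T`. -/
structure Coef {ι : Type*} [Fintype ι] (p : ι → E3) (T : Finset ι) (x : E3) (α : ι → ℝ) : Prop where
  supp : ∀ i, i ∉ T → α i = 0
  one : ∑ i, α i = 1
  pt : ∑ i, α i • p i = x
  nrm : ∑ i, α i * ‖p i‖ ^ 2 = ‖x‖ ^ 2

/-- The circle through the points of a triple. -/
def circ {ι : Type*} [Fintype ι] (p : ι → E3) (T : Finset ι) : Set E3 :=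
  {x | ∃ α, Coef p T x α}

theorem sum_three {ι M : Type*} [Fintype ι] [DecidableEq ι] [AddCommMonoid M] {u v w : ι}
    (huv : u ≠ v) (huw : u ≠ w) (hvw : v ≠ w) (g : ι → M)
    (hg : ∀ i, i ∉ ({u, v, w} : Finset ι) → g i = 0) : ∑ i, g i = g u + g v + g w := by
  rw [← Finset.sum_subset (Finset.subset_univ ({u, v, w} : Finset ι)) (fun i _ hi => hg i hi)]
  rw [Finset.sum_insert (by simp [huv, huw]), Finset.sum_insert (by simp [hvw]),
    Finset.sum_singleton, add_assoc]

/-- Function with prescribed values at three points. -/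
def three {ι : Type*} [DecidableEq ι] (u v w : ι) (a b c : ℝ) : ι → ℝ :=
  fun i => if i = u then a else if i = v then b else if i = w then c else 0

theorem three_coef {ι : Type*} [Fintype ι] [DecidableEq ι] (p : ι → E3) {u v w : ι}
    (huv : u ≠ v) (huw : u ≠ w) (hvw : v ≠ w) {a b c : ℝ} {x : E3} (h1 : a + b + c = 1)
    (hx : a • p u + b • p v + c • p w = x)
    (hn : a * ‖p u‖ ^ 2 + b * ‖p v‖ ^ 2 + c * ‖p w‖ ^ 2 = ‖x‖ ^ 2) :
    Coef p {u, v, w} x (three u v w a b c) := by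
  have hs : ∀ i, i ∉ ({u, v, w} : Finset ι) → three u v w a b c i = 0 := by
    intro i hi
    simp only [Finset.mem_insert, Finset.mem_singleton, not_or] at hi
    simp [three, hi]
  have e1 : three u v w a b c u = a := by simp [three]
  have e2 : three u v w a b c v = b := by simp [three, huv.symm]
  have e3 : three u v w a b c w = c := by simp [three, huw.symm, hvw.symm]
  refine ⟨hs, ?_, ?_, ?_⟩
  · rw [sum_three huv huw hvw _ hs, e1, e2, e3, h1]
  · rw [sum_three huv huw hvw _ (fun i hi => by rw [hs i hi, zero_smul]), e1, e2, e3, hx]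
  · rw [sum_three huv huw hvw _ (fun i hi => by rw [hs i hi, zero_mul]), e1, e2, e3, hn]

theorem norm_sq_of_dist {a b c o x : E3} {α β γ r : ℝ} (h1 : α + β + γ = 1)
    (hx : α • a + β • b + γ • c = x) (ha : dist a o = r) (hb : dist b o = r) (hc : dist c o = r) :
    α * ‖a‖ ^ 2 + β * ‖b‖ ^ 2 + γ * ‖c‖ ^ 2 - ‖x‖ ^ 2 = r ^ 2 - dist x o ^ 2 := by
  have e : ∀ y : E3, dist y o ^ 2 = ‖y‖ ^ 2 - 2 * inner ℝ y o + ‖o‖ ^ 2 := fun y => by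
    rw [dist_eq_norm, norm_sub_sq_real]
  have ha' := e a
  have hb' := e b
  have hc' := e c
  have hx' := e x
  rw [ha] at ha'
  rw [hb] at hb'
  rw [hc] at hc'
  have hi : inner ℝ x o = α * inner ℝ a o + β * inner ℝ b o + γ * inner ℝ c o := by
    rw [← hx]
    simp only [inner_add_left, real_inner_smul_left]
  rw [hi] at hx'
  have hγ : γ = 1 - α - β := by linarith
  subst hγ
  linear_combination (-α) * ha' - β * hb' - (1 - α - β) * hc' + hx'

theorem circ_isCircle {ι : Type*} [Fintype ι] [DecidableEq ι] (p : ι → E3) {u v w : ι}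
    (huv : u ≠ v) (huw : u ≠ w) (hvw : v ≠ w) (hli : LinearIndependent ℝ ![p u, p v, p w]) :
    IsCircle 3 (circ p {u, v, w}) := by
  have hai : AffineIndependent ℝ ![p u, p v, p w] := hli.affineIndependent
  let s : Affine.Simplex ℝ E3 2 := ⟨![p u, p v, p w], hai⟩
  have da : dist (p u) s.circumcenter = s.circumradius := s.dist_circumcenter_eq_circumradius 0
  have db : dist (p v) s.circumcenter = s.circumradius := s.dist_circumcenter_eq_circumradius 1
  have dc : dist (p w) s.circumcenter = s.circumradius := s.dist_circumcenter_eq_circumradius 2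
  refine ⟨affineSpan ℝ (Set.range s.points), s.circumcenter, s.circumradius, ?_,
    s.circumcenter_mem_affineSpan, s.circumradius_pos, ?_⟩
  · rw [direction_affineSpan]
    exact s.independent.finrank_vectorSpan (by simp)
  · ext x
    constructor
    · rintro ⟨α, h⟩
      have h1 : α u + α v + α w = 1 := by
        rw [← h.one, sum_three huv huw hvw _ h.supp]
      have hx : α u • p u + α v • p v + α w • p w = x := by
        rw [← h.pt, sum_three huv huw hvw _ (fun i hi => by rw [h.supp i hi, zero_smul])]
      have hn : α u * ‖p u‖ ^ 2 + α v * ‖p v‖ ^ 2 + α w * ‖p w‖ ^ 2 = ‖x‖ ^ 2 := by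
        rw [← h.nrm, sum_three huv huw hvw _ (fun i hi => by rw [h.supp i hi, zero_mul])]
      refine ⟨?_, ?_⟩
      · have hw : ∑ i, ![α u, α v, α w] i = 1 := by simpa [Fin.sum_univ_three] using h1
        have := affineCombination_mem_affineSpan (k := ℝ) hw s.points
        rw [Finset.affineCombination_eq_linear_combination _ _ _ hw] at this
        rw [← hx]
        simpa [Fin.sum_univ_three, s] using this
      · have := norm_sq_of_dist h1 hx da db dc
        rw [hn, sub_self] at this
        have h2 : dist x s.circumcenter ^ 2 = s.circumradius ^ 2 := by linarith
        exact (pow_left_inj₀ dist_nonneg s.circumradius_pos.le two_ne_zero).mp h2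
    · rintro ⟨hx, hd⟩
      obtain ⟨W, hW, rfl⟩ := eq_affineCombination_of_mem_affineSpan_of_fintype hx
      rw [Finset.affineCombination_eq_linear_combination _ _ _ hW] at hd ⊢
      have hW' : W 0 + W 1 + W 2 = 1 := by simpa [Fin.sum_univ_three] using hW
      have hx' : W 0 • p u + W 1 • p v + W 2 • p w = ∑ i, W i • s.points i := by
        simp [Fin.sum_univ_three, s]
      refine ⟨three u v w (W 0) (W 1) (W 2), three_coef p huv huw hvw hW' hx' ?_⟩
      have := norm_sq_of_dist hW' hx' da db dc
      rw [hd] at this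
      linarith

theorem exists_arc {ι : Type*} [Fintype ι] [DecidableEq ι] (p : ι → E3) {u v w : ι}
    (huv : u ≠ v) (huw : u ≠ w) (hvw : v ≠ w) (hli : LinearIndependent ℝ ![p u, p v, p w]) :
    ∃ A : Set E3, IsCompact A ∧ IsConnected A ∧ p u ∈ A ∧ p v ∈ A ∧
      ∀ x ∈ A, ∃ α, Coef p {u, v, w} x α ∧ 0 ≤ α u ∧ 0 ≤ α v ∧ α w ≤ 0 := by
  set a := p u - p w with ha
  set b := p v - p w with hb
  let g : ℝ → E3 := fun t => t • a + (1 - t) • b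
  have hg : ∀ t, g t ≠ 0 := by
    intro t h
    have hl := Fintype.linearIndependent_iff.mp hli ![t, 1 - t, -1] (by
      simp only [Fin.sum_univ_three]
      simp only [g, ha, hb] at h
      simp
      rw [← h]
      module) 
    have := hl 2
    simp at this
  have hgc : Continuous g := by fun_prop
  let N : ℝ → ℝ := fun t => t * ‖a‖ ^ 2 + (1 - t) * ‖b‖ ^ 2
  let k : ℝ → ℝ := fun t => N t / ‖g t‖ ^ 2
  have hgp : ∀ t, 0 < ‖g t‖ ^ 2 := fun t => by
    have := norm_pos_iff.mpr (hg t)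
    positivity
  have hkc : Continuous k := by
    apply Continuous.div
    · fun_prop
    · fun_prop
    · intro t
      exact (hgp t).ne'
  have hgn : ∀ t, ‖g t‖ ^ 2 = N t - t * (1 - t) * ‖a - b‖ ^ 2 := by
    intro t
    simp only [g, N]
    rw [norm_add_sq_real, norm_sub_sq_real a b, norm_smul, norm_smul, real_inner_smul_left,
      real_inner_smul_right, mul_pow, mul_pow, Real.norm_eq_abs, Real.norm_eq_abs, sq_abs, sq_abs]
    ring
  let F : ℝ → E3 := fun t => p w + k t • g t
  have hFc : Continuous F := by fun_prop
  have hkg : ∀ t, k t * ‖g t‖ ^ 2 = N t := fun t => div_mul_cancel₀ _ (hgp t).ne'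
  refine ⟨F '' Set.Icc 0 1, isCompact_Icc.image hFc, ?_, ⟨1, by simp, ?_⟩, ⟨0, by simp, ?_⟩, ?_⟩
  · exact (isConnected_Icc zero_le_one).image _ hFc.continuousOn
  · have h1 := hkg 1
    have h2 : g 1 = a := by simp [g]
    have h3 : N 1 = ‖a‖ ^ 2 := by simp [N]
    have h4 := hgp 1
    rw [h3, h2] at h1
    rw [h2] at h4
    have h5 : k 1 = 1 := by
      have : (k 1 - 1) * ‖a‖ ^ 2 = 0 := by linarith
      rcases mul_eq_zero.mp this with h | h <;> linarith
    simp only [F, h5, h2, ha]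
    module
  · have h1 := hkg 0
    have h2 : g 0 = b := by simp [g]
    have h3 : N 0 = ‖b‖ ^ 2 := by simp [N]
    have h4 := hgp 0
    rw [h3, h2] at h1
    rw [h2] at h4
    have h5 : k 0 = 1 := by
      have : (k 0 - 1) * ‖b‖ ^ 2 = 0 := by linarith
      rcases mul_eq_zero.mp this with h | h <;> linarith
    simp only [F, h5, h2, hb]
    module
  · rintro x ⟨t, ⟨ht0, ht1⟩, rfl⟩
    have hk1 : 1 ≤ k t := by
      rw [one_le_div (hgp t), hgn t]
      have : 0 ≤ t * (1 - t) * ‖a - b‖ ^ 2 :=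
        mul_nonneg (mul_nonneg ht0 (by linarith)) (by positivity)
      linarith
    refine ⟨three u v w (k t * t) (k t * (1 - t)) (1 - k t),
      three_coef p huv huw hvw (by ring) ?_ ?_, ?_, ?_, ?_⟩
    · simp only [F, g, ha, hb]
      module
    · have e1 : ‖p u‖ ^ 2 = ‖p w‖ ^ 2 + 2 * inner ℝ (p w) a + ‖a‖ ^ 2 := by
        rw [← norm_add_sq_real, ha]; congr 2; module
      have e2 : ‖p v‖ ^ 2 = ‖p w‖ ^ 2 + 2 * inner ℝ (p w) b + ‖b‖ ^ 2 := by
        rw [← norm_add_sq_real, hb]; congr 2; module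
      have e3 : ‖F t‖ ^ 2 = ‖p w‖ ^ 2 + 2 * (k t * (t * inner ℝ (p w) a
          + (1 - t) * inner ℝ (p w) b)) + k t * N t := by
        rw [← hkg t]
        simp only [F]
        rw [norm_add_sq_real, norm_smul, real_inner_smul_right, mul_pow, Real.norm_eq_abs, sq_abs]
        have : inner ℝ (p w) (g t) = t * inner ℝ (p w) a + (1 - t) * inner ℝ (p w) b := by
          simp only [g, inner_add_right, real_inner_smul_right]
        rw [this]
        ring
      rw [e3, e1, e2]
      simp only [N]
      ring
    · simp only [three, if_true]
      exact mul_nonneg (by linarith) ht0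
    · simp only [three, if_neg huv.symm, if_true]
      exact mul_nonneg (by linarith) (by linarith)
    · simp only [three, if_neg huw.symm, if_neg hvw.symm, if_true]
      linarith

theorem coef_unique {ι : Type*} [Fintype ι] [DecidableEq ι] {p : ι → E3} (hp : Generic p)
    (hι : 5 ≤ Fintype.card ι) {T T' : Finset ι} {x : E3} {α β : ι → ℝ} (hα : Coef p T x α)
    (hβ : Coef p T' x β) (hc : (T ∪ T').card ≤ 5) : α = β := by
  obtain ⟨S, hS, hS5⟩ := Finset.exists_superset_card_eq hc hι
  let f : Fin 5 ↪ ι := (S.equivFinOfCardEq hS5).symm.toEmbedding.trans (Function.Embedding.subtype _)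
  have hz : ∀ i, i ∉ S → α i - β i = 0 := by
    intro i hi
    rw [hα.supp i (fun h => hi (hS (Finset.mem_union_left _ h))),
      hβ.supp i (fun h => hi (hS (Finset.mem_union_right _ h))), sub_zero]
  have hsum : ∀ {M : Type} [AddCommMonoid M] (g : ι → M), (∀ i, i ∉ S → g i = 0) →
      ∑ k, g (f k) = ∑ i, g i := by
    intro M _ g hg
    rw [← Finset.sum_subset (Finset.subset_univ S) (fun i _ hi => hg i hi), ← Finset.sum_coe_sort S]
    exact Equiv.sum_comp (S.equivFinOfCardEq hS5).symm (fun i : S => g i)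
  have h := hp.g2 f (fun k => α (f k) - β (f k)) ?_ ?_ ?_
  · funext i
    by_cases hi : i ∈ S
    · have := congrFun h (S.equivFinOfCardEq hS5 ⟨i, hi⟩)
      simp [f] at this
      linarith
    · linarith [hz i hi]
  · rw [hsum (fun i => α i - β i) hz, Finset.sum_sub_distrib, hα.one, hβ.one, sub_self]
  · rw [hsum (fun i => (α i - β i) • p i) (fun i hi => by rw [hz i hi, zero_smul])]
    simp only [sub_smul]
    rw [Finset.sum_sub_distrib, hα.pt, hβ.pt, sub_self]
  · rw [hsum (fun i => (α i - β i) * ‖p i‖ ^ 2) (fun i hi => by rw [hz i hi, zero_mul])]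
    simp only [sub_mul]
    rw [Finset.sum_sub_distrib, hα.nrm, hβ.nrm, sub_self]

theorem quad_of_norm {a b c x : E3} {α β γ : ℝ} (h1 : α + β + γ = 1)
    (hx : α • a + β • b + γ • c = x)
    (hn : α * ‖a‖ ^ 2 + β * ‖b‖ ^ 2 + γ * ‖c‖ ^ 2 = ‖x‖ ^ 2) : quad3 α β γ a b c = 0 := by
  subst hx
  have hγ : γ = 1 - α - β := by linarith
  subst hγ
  simp only [EuclideanSpace.real_norm_sq_eq, Fin.sum_univ_three, PiLp.add_apply, PiLp.smul_apply,
    smul_eq_mul] at hn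
  simp only [quad3, sqd]
  linear_combination hn

theorem coef_disjoint {ι : Type*} [Fintype ι] [DecidableEq ι] {p : ι → E3} (hp : Generic p)
    {T T' : Finset ι} {x : E3} {α β : ι → ℝ} (hα : Coef p T x α)
    (hβ : Coef p T' x β) (hT : T.card = 3) (hT' : T'.card = 3) (hd : Disjoint T T') : False := by
  obtain ⟨a, b, c, hab, hac, hbc, rfl⟩ := Finset.card_eq_three.mp hT
  obtain ⟨d, e, f, hde, hdf, hef, rfl⟩ := Finset.card_eq_three.mp hT'
  simp only [Finset.disjoint_insert_left, Finset.disjoint_singleton_left, Finset.mem_insert,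
    Finset.mem_singleton, not_or] at hd
  obtain ⟨⟨n1, n2, n3⟩, ⟨n4, n5, n6⟩, n7, n8, n9⟩ := hd
  have hinj : Function.Injective ![a, b, c, d, e, f] := by
    intro i j hij
    fin_cases i <;> fin_cases j <;> first | rfl | (exfalso; simp at hij; simp_all)
  have a1 : α a + α b + α c = 1 := by rw [← hα.one, sum_three hab hac hbc _ hα.supp]
  have a2 : α a • p a + α b • p b + α c • p c = x := by
    rw [← hα.pt, sum_three hab hac hbc _ (fun i hi => by rw [hα.supp i hi, zero_smul])]
  have a3 : α a * ‖p a‖ ^ 2 + α b * ‖p b‖ ^ 2 + α c * ‖p c‖ ^ 2 = ‖x‖ ^ 2 := by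
    rw [← hα.nrm, sum_three hab hac hbc _ (fun i hi => by rw [hα.supp i hi, zero_mul])]
  have b1 : β d + β e + β f = 1 := by rw [← hβ.one, sum_three hde hdf hef _ hβ.supp]
  have b2 : β d • p d + β e • p e + β f • p f = x := by
    rw [← hβ.pt, sum_three hde hdf hef _ (fun i hi => by rw [hβ.supp i hi, zero_smul])]
  have b3 : β d * ‖p d‖ ^ 2 + β e * ‖p e‖ ^ 2 + β f * ‖p f‖ ^ 2 = ‖x‖ ^ 2 := by
    rw [← hβ.nrm, sum_three hde hdf hef _ (fun i hi => by rw [hβ.supp i hi, zero_mul])]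
  have h := hp.g3 ⟨![a, b, c, d, e, f], hinj⟩ ![α a, α b, α c, -β d, -β e, -β f] ?_ ?_ ?_ ?_
  · have h0 : α a = 0 := congrFun h 0
    have h1 : α b = 0 := congrFun h 1
    have h2 : α c = 0 := congrFun h 2
    linarith
  · simp [Fin.sum_univ_six]
    linarith
  · have : α a • p a + α b • p b + α c • p c - (β d • p d + β e • p e + β f • p f) = 0 := by
      rw [a2, b2, sub_self]
    simp [Fin.sum_univ_six]
    rw [← this]
    module
  · simp [Fin.sum_univ_six]
    linarith
  · exact quad_of_norm a1 a2 a3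

theorem two_points {a b x : E3} (hab : a ≠ b) {α β : ℝ} (h1 : α + β = 1)
    (hx : α • a + β • b = x) (hn : α * ‖a‖ ^ 2 + β * ‖b‖ ^ 2 = ‖x‖ ^ 2) : α * β = 0 := by
  have h := quad_of_norm (a := a) (b := b) (c := 0) (x := x) (α := α) (β := β) (γ := 0) (by linarith) (by simpa using hx)
    (by simpa using hn)
  have hs : sqd (a : Fin 3 → ℝ) b = ‖a - b‖ ^ 2 := by
    simp [sqd, EuclideanSpace.real_norm_sq_eq, Fin.sum_univ_three]
  simp only [quad3, mul_zero, zero_mul, add_zero, hs] at h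
  have : ‖a - b‖ ^ 2 ≠ 0 := pow_ne_zero _ (norm_ne_zero_iff.mpr (sub_ne_zero.mpr hab))
  exact (mul_eq_zero.mp h).resolve_right this

theorem coef_point {ι : Type*} [Fintype ι] [DecidableEq ι] (p : ι → E3) (w : ι) :
    Coef p {w} (p w) (Pi.single w 1) := by
  refine ⟨?_, ?_, ?_, ?_⟩
  · intro i hi
    simp at hi
    simp [hi]
  · simp
  · simp [Pi.single_apply]
  · simp [Pi.single_apply]

theorem generic_injective {ι : Type*} [Fintype ι] [DecidableEq ι] {p : ι → E3} (hp : Generic p)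
    (hι : 5 ≤ Fintype.card ι) : Function.Injective p := by
  intro u v h
  have h1 := coef_point p u
  have h2 := coef_point p v
  rw [h] at h1
  have := congrFun (coef_unique hp hι h1 h2 ((Finset.card_union_le _ _).trans (by simp))) u
  by_contra hne
  simp [hne] at this

theorem crossing {ι : Type*} [Fintype ι] [DecidableEq ι] {p : ι → E3} (hp : Generic p)
    (hι : 5 ≤ Fintype.card ι) {e f T T' : Finset ι} {x : E3} {α β : ι → ℝ} (hα : Coef p T x α)
    (hβ : Coef p T' x β) (hT : T.card = 3) (hT' : T'.card = 3) (he : e.card = 2) (hf : f.card = 2)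
    (heT : e ⊆ T) (hfT : f ⊆ T') (hef : e ≠ f)
    (hα1 : ∀ i ∈ e, 0 ≤ α i) (hα2 : ∀ i, i ∉ e → α i ≤ 0)
    (hβ1 : ∀ i ∈ f, 0 ≤ β i) (hβ2 : ∀ i, i ∉ f → β i ≤ 0) :
    ∃ w, w ∈ e ∧ w ∈ f ∧ x = p w := by
  have hnd : ¬ Disjoint T T' := fun hd => coef_disjoint hp hα hβ hT hT' hd
  have hcard : (T ∪ T').card ≤ 5 := by
    have h1 := Finset.card_union_add_card_inter T T'
    have h2 : 0 < (T ∩ T').card := by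
      rw [Finset.card_pos]
      exact Finset.not_disjoint_iff_nonempty_inter.mp hnd
    omega
  obtain rfl := coef_unique hp hι hα hβ hcard
  obtain ⟨w, hw⟩ : ∃ w, 0 < α w := by
    by_contra hc
    push Not at hc
    have := Finset.sum_nonpos (s := Finset.univ) (fun i _ => hc i)
    rw [hα.one] at this
    linarith
  have hwe : w ∈ e := by
    by_contra h
    linarith [hα2 w h]
  have hwf : w ∈ f := by
    by_contra h
    linarith [hβ2 w h]
  have key : ∀ i, i ≠ w → α i = 0 := by
    intro i hiw
    by_contra hi0
    have hwi : ({w, i} : Finset ι).card = 2 := Finset.card_pair hiw.symm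
    have hief : ¬ (i ∈ e ∧ i ∈ f) := by
      rintro ⟨h1, h2⟩
      apply hef
      have e1 : ({w, i} : Finset ι) = e := Finset.eq_of_subset_of_card_le
        (by intro y; simp; rintro (rfl | rfl) <;> assumption) (by omega)
      have e2 : ({w, i} : Finset ι) = f := Finset.eq_of_subset_of_card_le
        (by intro y; simp; rintro (rfl | rfl) <;> assumption) (by omega)
      rw [← e1, ← e2]
    have hle : α i ≤ 0 := by
      by_cases h : i ∈ e
      · exact hβ2 i (fun h' => hief ⟨h, h'⟩)
      · exact hα2 i h
    have hlt : α i < 0 := lt_of_le_of_ne hle hi0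
    have hie : i ∉ e := fun h => by linarith [hα1 i h]
    have hif : i ∉ f := fun h => by linarith [hβ1 i h]
    have hiT : i ∈ T := by
      by_contra h
      exact hi0 (hα.supp i h)
    have hiT' : i ∈ T' := by
      by_contra h
      exact hi0 (hβ.supp i h)
    have E : e = T.erase i := Finset.eq_of_subset_of_card_le
      (fun y hy => Finset.mem_erase.mpr ⟨fun h => hie (h ▸ hy), heT hy⟩)
      (by rw [Finset.card_erase_of_mem hiT]; omega)
    have F : f = T'.erase i := Finset.eq_of_subset_of_card_le
      (fun y hy => Finset.mem_erase.mpr ⟨fun h => hif (h ▸ hy), hfT hy⟩)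
      (by rw [Finset.card_erase_of_mem hiT']; omega)
    have hTT : T ≠ T' := fun h => hef (by rw [E, F, h])
    have hz : ∀ j, j ∉ ({w, i} : Finset ι) → α j = 0 := by
      intro j hj
      simp only [Finset.mem_insert, Finset.mem_singleton, not_or] at hj
      by_contra h0
      have hjT : j ∈ T := by
        by_contra h
        exact h0 (hα.supp j h)
      have hjT' : j ∈ T' := by
        by_contra h
        exact h0 (hβ.supp j h)
      have h3 : ({w, i, j} : Finset ι).card = 3 :=
        Finset.card_eq_three.mpr ⟨w, i, j, hiw.symm, Ne.symm hj.1, Ne.symm hj.2, rfl⟩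
      apply hTT
      have e1 : ({w, i, j} : Finset ι) = T := Finset.eq_of_subset_of_card_le
        (by
          intro y
          simp only [Finset.mem_insert, Finset.mem_singleton]
          rintro (rfl | rfl | rfl)
          · exact heT hwe
          · exact hiT
          · exact hjT) (by omega)
      have e2 : ({w, i, j} : Finset ι) = T' := Finset.eq_of_subset_of_card_le
        (by
          intro y
          simp only [Finset.mem_insert, Finset.mem_singleton]
          rintro (rfl | rfl | rfl)
          · exact hfT hwf
          · exact hiT'
          · exact hjT') (by omega)
      rw [← e1, ← e2]
    have hs : ∀ {M : Type} [AddCommMonoid M] (g : ι → M),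
        (∀ j, j ∉ ({w, i} : Finset ι) → g j = 0) → g w + g i = ∑ j, g j := by
      intro M _ g hg
      rw [← Finset.sum_subset (Finset.subset_univ _) (fun j _ hj => hg j hj),
        Finset.sum_pair hiw.symm]
    have h1 := hs α hz
    have h2 := hs (fun j => α j • p j) (fun j hj => by simp only [hz j hj, zero_smul])
    have h3 := hs (fun j => α j * ‖p j‖ ^ 2) (fun j hj => by simp only [hz j hj, zero_mul])
    rw [hα.one] at h1
    rw [hα.pt] at h2
    rw [hα.nrm] at h3
    have := two_points (fun h => hiw ((generic_injective hp hι) h).symm) h1 h2 h3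
    rcases mul_eq_zero.mp this with h | h <;> linarith
  have hw1 : α w = 1 := by
    rw [← hα.one, Finset.sum_eq_single w (fun i _ hi => key i hi) (by simp)]
  refine ⟨w, hwe, hwf, ?_⟩
  rw [← hα.pt, Finset.sum_eq_single w (fun i _ hi => by rw [key i hi, zero_smul]) (by simp), hw1,
    one_smul]

theorem exists_drawing {V ι : Type*} [Fintype V] [DecidableEq V] [Fintype ι] [DecidableEq ι]
    {p : ι → E3} (hp : Generic p)
    (hι : 5 ≤ Fintype.card ι) (emb : V ↪ ι) (third : Sym2 V → ι)
    (h3 : ∀ e : Sym2 V, ¬ e.IsDiag → ∀ v ∈ e, emb v ≠ third e) :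
    ∃ D : CircularArcDrawing 3 (⊤ : SimpleGraph V), ∀ e ∈ (⊤ : SimpleGraph V).edgeSet,
      IsCircle 3 (circ p (insert (third e) (e.toFinset.map emb))) ∧
      D.arc e ⊆ circ p (insert (third e) (e.toFinset.map emb)) := by
  have hmemF : ∀ (e : Sym2 V) (v : V), emb v ∈ e.toFinset.map emb ↔ v ∈ e := by
    intro e v
    simp [Sym2.mem_toFinset]
  have hnd : ∀ e ∈ (⊤ : SimpleGraph V).edgeSet, ¬ e.IsDiag := fun e he =>
    SimpleGraph.not_isDiag_of_mem_edgeSet _ he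
  have hcard2 : ∀ e : Sym2 V, ¬ e.IsDiag → (e.toFinset.map emb).card = 2 := by
    intro e he
    rw [Finset.card_map, Sym2.card_toFinset_of_not_isDiag _ he]
  have hnot : ∀ e : Sym2 V, ¬ e.IsDiag → third e ∉ e.toFinset.map emb := by
    intro e he h
    obtain ⟨v, hv, hv'⟩ := Finset.mem_map.mp h
    exact h3 e he v (Sym2.mem_toFinset.mp hv) hv'
  have hcard3 : ∀ e : Sym2 V, ¬ e.IsDiag →
      (insert (third e) (e.toFinset.map emb)).card = 3 := by
    intro e he
    rw [Finset.card_insert_of_notMem (hnot e he), hcard2 e he]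
  have harc : ∀ e : Sym2 V, ∃ A : Set E3, ¬ e.IsDiag →
      IsCircle 3 (circ p (insert (third e) (e.toFinset.map emb))) ∧
      IsCompact A ∧ IsConnected A ∧ (∀ v ∈ e, p (emb v) ∈ A) ∧
      ∀ x ∈ A, ∃ α, Coef p (insert (third e) (e.toFinset.map emb)) x α ∧
        (∀ i ∈ e.toFinset.map emb, 0 ≤ α i) ∧ (∀ i, i ∉ e.toFinset.map emb → α i ≤ 0) := by
    intro e
    by_cases he : e.IsDiag
    · exact ⟨∅, fun h => absurd he h⟩
    induction e using Sym2.ind with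
    | _ a b =>
    have hab : a ≠ b := by simpa using he
    have huv : emb a ≠ emb b := fun h => hab (emb.injective h)
    have huw := h3 _ he a (by simp)
    have hvw := h3 _ he b (by simp)
    have hli := hp.g1 _ _ _ huv huw hvw
    obtain ⟨A, h1, h2, h4, h5, h6⟩ := exists_arc p huv huw hvw hli
    have hE : (s(a, b)).toFinset.map emb = {emb a, emb b} := by
      ext i
      simp only [Finset.mem_map, Sym2.mem_toFinset, Sym2.mem_iff, Finset.mem_insert,
        Finset.mem_singleton]
      constructor
      · rintro ⟨v, rfl | rfl, rfl⟩ <;> simp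
      · rintro (rfl | rfl)
        · exact ⟨a, Or.inl rfl, rfl⟩
        · exact ⟨b, Or.inr rfl, rfl⟩
    have hB : insert (third s(a, b)) ((s(a, b)).toFinset.map emb)
        = {emb a, emb b, third s(a, b)} := by
      rw [hE]
      ext i
      simp only [Finset.mem_insert, Finset.mem_singleton]
      tauto
    refine ⟨A, fun _ => ⟨?_, h1, h2, ?_, ?_⟩⟩
    · rw [hB]
      exact circ_isCircle p huv huw hvw hli
    · intro v hv
      rcases Sym2.mem_iff.mp hv with rfl | rfl
      · exact h4
      · exact h5
    · intro x hx
      obtain ⟨α, hα, k1, k2, k3⟩ := h6 x hx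
      refine ⟨α, by rw [hB]; exact hα, ?_, ?_⟩
      · rw [hE]
        intro i hi
        simp only [Finset.mem_insert, Finset.mem_singleton] at hi
        rcases hi with rfl | rfl <;> assumption
      · rw [hE]
        intro i hi
        simp only [Finset.mem_insert, Finset.mem_singleton, not_or] at hi
        by_cases h : i = third s(a, b)
        · rw [h]; exact k3
        · exact (hα.supp i (by simp [hi, h])).le
  choose arc harc using harc
  have hvert : ∀ e ∈ (⊤ : SimpleGraph V).edgeSet, ∀ w, p (emb w) ∈ arc e → w ∈ e := by
    intro e he w hw
    obtain ⟨α, hα, k1, k2⟩ := (harc e (hnd e he)).2.2.2.2 _ hw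
    have := coef_unique hp hι hα (coef_point p (emb w))
      ((Finset.card_union_le _ _).trans (by rw [hcard3 e (hnd e he)]; simp))
    by_contra hc
    have h := k2 (emb w) (fun h => hc ((hmemF e w).mp h))
    rw [this] at h
    simp at h
    linarith
  refine ⟨⟨fun v => p (emb v), (generic_injective hp hι).comp emb.injective, arc, ?_, ?_, ?_,
    hvert⟩, ?_⟩
  · intro e he
    obtain ⟨h1, h2, h4, h5, h6⟩ := harc e (hnd e he)
    exact ⟨_, h1, fun x hx => ⟨_, (h6 x hx).choose_spec.1⟩, h2, h4⟩
  · intro e he v hv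
    exact (harc e (hnd e he)).2.2.2.1 v hv
  · intro e he f hf hef
    ext x
    constructor
    · rintro ⟨hxe, hxf⟩
      obtain ⟨α, hα, k1, k2⟩ := (harc e (hnd e he)).2.2.2.2 _ hxe
      obtain ⟨β, hβ, l1, l2⟩ := (harc f (hnd f hf)).2.2.2.2 _ hxf
      have hne : e.toFinset.map emb ≠ f.toFinset.map emb := by
        intro h
        apply hef
        apply Sym2.ext
        intro v
        rw [← hmemF e v, ← hmemF f v, h]
      obtain ⟨w, w1, w2, rfl⟩ := crossing hp hι hα hβ (hcard3 e (hnd e he)) (hcard3 f (hnd f hf))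
        (hcard2 e (hnd e he)) (hcard2 f (hnd f hf)) (Finset.subset_insert _ _)
        (Finset.subset_insert _ _) hne k1 k2 l1 l2
      obtain ⟨v, hv, rfl⟩ := Finset.mem_map.mp w1
      exact ⟨v, ⟨(hmemF e v).mp w1, (hmemF f v).mp w2⟩, rfl⟩
    · rintro ⟨w, ⟨h1, h2⟩, rfl⟩
      exact ⟨(harc e (hnd e he)).2.2.2.1 w h1, (harc f (hnd f hf)).2.2.2.1 w h2⟩
  · intro e he
    obtain ⟨h1, h2, h4, h5, h6⟩ := harc e (hnd e he)
    exact ⟨h1, fun x hx => ⟨_, (h6 x hx).choose_spec.1⟩⟩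

/-- Sum of the two ends of a pair. -/
def endSum {V : Type*} [AddCommGroup V] (e : Sym2 V) : V :=
  Sym2.lift ⟨fun a b => a + b, fun a b => add_comm a b⟩ e

/-- The third point on the circle of an edge. -/
def thirdPt {V : Type*} [AddCommGroup V] [DecidableEq V] (e : Sym2 V) : V ⊕ Fin 6 :=
  if -endSum e ∈ e then Sum.inr 0 else Sum.inl (-endSum e)

/-- The block of an edge. -/
def blk {V : Type*} [AddCommGroup V] [DecidableEq V] (e : Sym2 V) : Finset (V ⊕ Fin 6) :=
  insert (thirdPt e) (e.toFinset.map Function.Embedding.inl)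

theorem blk_mk {V : Type*} [AddCommGroup V] [DecidableEq V] {a b c : V} (h : a + b + c = 0)
    (hac : a ≠ c) (hbc : b ≠ c) : blk s(a, b) = {Sum.inl a, Sum.inl b, Sum.inl c} := by
  have hc : -endSum s(a, b) = c := by
    simp only [endSum, Sym2.lift_mk]
    exact neg_eq_of_add_eq_zero_right h
  have : thirdPt s(a, b) = Sum.inl c := by
    simp [thirdPt, hc, hac.symm, hbc.symm]
  ext i
  simp only [blk, this, Finset.mem_insert, Finset.mem_map, Sym2.mem_toFinset, Sym2.mem_iff,
    Finset.mem_singleton, Function.Embedding.inl_apply]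
  constructor
  · rintro (rfl | ⟨v, rfl | rfl, rfl⟩) <;> simp
  · rintro (rfl | rfl | rfl) <;> simp

theorem card_blocks {V : Type*} [AddCommGroup V] [DecidableEq V] [Fintype V] :
    ((Finset.univ.filter fun e : Sym2 V => ¬ e.IsDiag).image blk).card ≤
      ((Fintype.card V) ^ 2 + 5 * Fintype.card V + 6) / 6 := by
  set n := Fintype.card V with hn
  set E := Finset.univ.filter fun e : Sym2 V => ¬ e.IsDiag with hE
  have hEc : E.card * 2 = n * (n - 1) := by
    have h1 : E.card = n.choose 2 := by
      rw [← Sym2.card_subtype_not_diag, Fintype.card_subtype]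
    rw [h1, Nat.choose_two_right, Nat.div_two_mul_two_of_even (Nat.even_mul_pred_self n)]
  set E1 := E.filter fun e => -endSum e ∈ e with hE1
  set E2 := E.filter fun e => ¬ (-endSum e ∈ e) with hE2
  have h12 : E1.card + E2.card = E.card := Finset.card_filter_add_card_filter_not _
  have h1 : E1.card ≤ n := by
    have : E1 ⊆ Finset.univ.image fun a : V => s(a, -a - a) := by
      intro e he
      induction e using Sym2.ind with
      | _ a b =>
      have h := (Finset.mem_filter.mp he).2
      simp only [endSum, Sym2.lift_mk, Sym2.mem_iff] at h
      rw [Finset.mem_image]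
      rcases h with h | h
      · refine ⟨a, Finset.mem_univ _, ?_⟩
        have : b = -a - a := by
          nth_rewrite 2 [← h]
          abel
        rw [this]
      · refine ⟨b, Finset.mem_univ _, ?_⟩
        have : a = -b - b := by
          nth_rewrite 2 [← h]
          abel
        rw [Sym2.eq_swap, ← this]
    exact (Finset.card_le_card this).trans (Finset.card_image_le.trans (by simp [hn]))
  have h2 : 3 * (E2.image blk).card ≤ E2.card := by
    apply Finset.mul_card_image_le_card
    intro T hT
    obtain ⟨e, he, rfl⟩ := Finset.mem_image.mp hT
    induction e using Sym2.ind with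
    | _ a b =>
    obtain ⟨he1, he2⟩ := Finset.mem_filter.mp he
    have hab : a ≠ b := by simpa [hE] using he1
    obtain ⟨c, hc⟩ : ∃ c, c = -(a + b) := ⟨_, rfl⟩
    have he3 : c ≠ a ∧ c ≠ b := by
      simpa only [endSum, Sym2.lift_mk, Sym2.mem_iff, not_or, ← hc] using he2
    obtain ⟨hca, hcb⟩ := he3
    have hs : a + b + c = 0 := by rw [hc]; abel
    have hmem : ∀ x y z : V, x + y + z = 0 → x ≠ y → x ≠ z → y ≠ z → s(x, y) ∈ E2 := by
      intro x y z h hxy hxz hyz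
      have hz : -(x + y) = z := neg_eq_of_add_eq_zero_right h
      simp [hE2, hE, endSum, hz, hxy, hxz.symm, hyz.symm]
    have hs2 : a + c + b = 0 := by rw [← hs]; abel
    have hs3 : b + c + a = 0 := by rw [← hs]; abel
    have hsub : ({s(a, b), s(a, c), s(b, c)} : Finset (Sym2 V)) ⊆
        E2.filter fun e => blk e = blk s(a, b) := by
      intro e he
      simp only [Finset.mem_insert, Finset.mem_singleton] at he
      rw [Finset.mem_filter]
      rcases he with rfl | rfl | rfl
      · exact ⟨he, rfl⟩
      · refine ⟨hmem _ _ _ hs2 hca.symm hab hcb, ?_⟩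
        rw [blk_mk hs2 hab hcb, blk_mk hs hca.symm hcb.symm]
        ext i
        simp only [Finset.mem_insert, Finset.mem_singleton]
        tauto
      · refine ⟨hmem _ _ _ hs3 hcb.symm hab.symm hca, ?_⟩
        rw [blk_mk hs3 hab.symm hca, blk_mk hs hca.symm hcb.symm]
        ext i
        simp only [Finset.mem_insert, Finset.mem_singleton]
        tauto
    refine le_trans (le_of_eq ?_) (Finset.card_le_card hsub)
    symm
    apply Finset.card_eq_three.mpr
    refine ⟨_, _, _, ?_, ?_, ?_, rfl⟩
    · simp [hcb.symm, hca.symm]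
    · simp [hab, hca.symm]
    · simp [hab, hca.symm]
  have h3 : (E.image blk).card ≤ E1.card + (E2.image blk).card := by
    have : E = E1 ∪ E2 := (Finset.filter_union_filter_not_eq _ _).symm
    rw [this, Finset.image_union]
    exact (Finset.card_union_le _ _).trans (Nat.add_le_add_right Finset.card_image_le _)
  rw [Nat.le_div_iff_mul_le (by norm_num)]
  have h4 : n * (n - 1) + n = n ^ 2 := by
    cases n with
    | zero => rfl
    | succ m => simp; ring
  omega

/-- For every `n ≥ 1`, the complete graph `K_n` admits a crossing-free circular-arc drawing
in `ℝ³` covered by a family of at most `⌊(n² + 5n + 6)/6⌋` circles. -/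
theorem completeGraph_circle_cover_upper_bound (n : ℕ) (hn : 1 ≤ n) :
    ∃ (D : CircularArcDrawing 3 (⊤ : SimpleGraph (Fin n)))
      (𝒞 : Finset (Set (EuclideanSpace ℝ (Fin 3)))),
      (∀ C ∈ 𝒞, IsCircle 3 C) ∧ D.CoveredBy 𝒞 ∧
      𝒞.card ≤ (n ^ 2 + 5 * n + 6) / 6 := by
  classical
  have : NeZero n := ⟨by omega⟩
  obtain ⟨p, hp⟩ := exists_generic (Fin n ⊕ Fin 6)
  obtain ⟨D, hD⟩ := exists_drawing hp (by simp) Function.Embedding.inl (thirdPt (V := Fin n)) (by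
    intro e _ v hv h
    unfold thirdPt at h
    split_ifs at h with hc
    · exact absurd h (by simp)
    · exact hc ((Sum.inl_injective h) ▸ hv))
  refine ⟨D, ((Finset.univ.filter fun e : Sym2 (Fin n) => ¬ e.IsDiag).image blk).image (circ p),
    ?_, ?_, ?_⟩
  · intro C hC
    simp only [Finset.mem_image, Finset.mem_filter, Finset.mem_univ, true_and] at hC
    obtain ⟨_, ⟨e, he, rfl⟩, rfl⟩ := hC
    exact (hD e (by simpa using he)).1
  · intro e he
    refine ⟨circ p (blk e), ?_, (hD e he).2⟩
    apply Finset.mem_image_of_mem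
    apply Finset.mem_image_of_mem
    simp [SimpleGraph.not_isDiag_of_mem_edgeSet _ he]
  · refine Finset.card_image_le.trans ?_
    have := card_blocks (V := Fin n)
    rwa [Fintype.card_fin] at this
end
end

section
/- For all positive integers p and q, every crossing-free circular-arc drawing of the complete bipartite graph K_{p,q} in ℝ³ covered by a family of r circles satisfies r ≥ ⌈pq/4⌉. -/
open Set

noncomputable section

/-- Just above a real number there is a threshold below all larger elements of a finite set. -/
lemma exists_above (s : Finset ℝ) (x : ℝ) : ∃ c, x < c ∧ ∀ y ∈ s, x < y → c < y := by
  induction s using Finset.induction_on with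
  | empty => exact ⟨x + 1, by linarith, by simp⟩
  | insert a s _ ih =>
    obtain ⟨c, hc, hs⟩ := ih
    by_cases ha : x < a
    · refine ⟨min c ((x + a) / 2), lt_min hc (by linarith), ?_⟩
      intro y hy hxy
      rcases Finset.mem_insert.1 hy with rfl | hy
      · exact lt_of_le_of_lt (min_le_right _ _) (by linarith)
      · exact lt_of_le_of_lt (min_le_left _ _) (hs y hy hxy)
    · refine ⟨c, hc, ?_⟩
      intro y hy hxy
      rcases Finset.mem_insert.1 hy with rfl | hy
      · exact absurd hxy ha
      · exact hs y hy hxy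

lemma exists_below (s : Finset ℝ) (x : ℝ) : ∃ c, c < x ∧ ∀ y ∈ s, y < x → y < c := by
  obtain ⟨c, hc, h⟩ := exists_above (s.image (fun y => -y)) (-x)
  refine ⟨-c, by linarith, fun y hy hyx => ?_⟩
  have := h (-y) (Finset.mem_image_of_mem _ hy) (by linarith)
  linarith

/-- Number of pairs separated by a threshold. -/
lemma card_sep {p q : ℕ} (g : Fin p → ℝ) (h : Fin q → ℝ) (c : ℝ)
    (hg : ∀ i, g i ≠ c) (hh : ∀ j, h j ≠ c) (m k : ℕ)
    (hm : (Finset.univ.filter (fun i => g i < c)).card = m)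
    (hk : (Finset.univ.filter (fun j => h j < c)).card = k) :
    (((Finset.univ.filter (fun e : Fin p × Fin q =>
      (g e.1 < c ∧ c < h e.2) ∨ (h e.2 < c ∧ c < g e.1))).card : ℕ) : ℤ)
      = (m : ℤ) * (q - k) + (p - m) * k := by
  have e1 : (Finset.univ.filter (fun e : Fin p × Fin q =>
      (g e.1 < c ∧ c < h e.2) ∨ (h e.2 < c ∧ c < g e.1)))
      = ((Finset.univ.filter (fun i => g i < c)) ×ˢ (Finset.univ.filter (fun j => ¬ h j < c)))
        ∪ ((Finset.univ.filter (fun i => ¬ g i < c)) ×ˢ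
          (Finset.univ.filter (fun j => h j < c))) := by
    ext ⟨i, j⟩
    have h1 := lt_or_gt_of_ne (hg i)
    have h2 := lt_or_gt_of_ne (hh j)
    simp only [Finset.mem_filter, Finset.mem_univ, true_and, Finset.mem_union, Finset.mem_product]
    constructor
    · rintro (⟨a, b⟩ | ⟨a, b⟩)
      · exact Or.inl ⟨a, not_lt.2 b.le⟩
      · exact Or.inr ⟨not_lt.2 b.le, a⟩
    · rintro (⟨a, b⟩ | ⟨a, b⟩)
      · exact Or.inl ⟨a, h2.resolve_left b⟩
      · exact Or.inr ⟨b, h1.resolve_left a⟩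
  have hm' := Finset.card_filter_add_card_filter_not (s := (Finset.univ : Finset (Fin p)))
    (fun i => g i < c)
  have hk' := Finset.card_filter_add_card_filter_not (s := (Finset.univ : Finset (Fin q)))
    (fun j => h j < c)
  rw [hm, Finset.card_univ, Fintype.card_fin] at hm'
  rw [hk, Finset.card_univ, Fintype.card_fin] at hk'
  rw [e1, Finset.card_union_of_disjoint, Finset.card_product, Finset.card_product, hm, hk]
  · zify at hm' hk'
    push_cast
    rw [← hm', ← hk']
    ring
  · rw [Finset.disjoint_left]
    rintro ⟨i, j⟩ ha hb
    simp only [Finset.mem_filter, Finset.mem_univ, true_and, Finset.mem_product] at ha hb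
    exact hb.1 ha.1

/-- Some threshold separates at least half of the pairs. -/
lemma exists_threshold {p q : ℕ} (hp : 0 < p) (g : Fin p → ℝ) (h : Fin q → ℝ)
    (hg : Function.Injective g) (hgh : ∀ i j, g i ≠ h j) :
    ∃ c, (∀ i, g i ≠ c) ∧ (∀ j, h j ≠ c) ∧
      p * q ≤ 2 * (Finset.univ.filter (fun e : Fin p × Fin q =>
      (g e.1 < c ∧ c < h e.2) ∨ (h e.2 < c ∧ c < g e.1))).card := by
  set T : Finset (Fin p) := Finset.univ.filter
    (fun i => p ≤ 2 * (Finset.univ.filter (fun i' => g i' ≤ g i)).card) with hT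
  haveI : Nonempty (Fin p) := ⟨⟨0, hp⟩⟩
  have hTne : T.Nonempty := by
    obtain ⟨i, _, hi⟩ := Finset.exists_max_image (Finset.univ : Finset (Fin p)) g
      Finset.univ_nonempty
    refine ⟨i, ?_⟩
    simp only [hT, Finset.mem_filter, Finset.mem_univ, true_and]
    rw [Finset.filter_true_of_mem hi, Finset.card_univ, Fintype.card_fin]
    omega
  obtain ⟨i0, hi0, hmin⟩ := Finset.exists_min_image T g hTne
  have hle : p ≤ 2 * (Finset.univ.filter (fun i' => g i' ≤ g i0)).card := by
    simpa [hT] using hi0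
  have hlt : 2 * (Finset.univ.filter (fun i' => g i' < g i0)).card < p := by
    rcases (Finset.univ.filter (fun i' => g i' < g i0)).eq_empty_or_nonempty with he | hne
    · rw [he]; simpa using hp
    · obtain ⟨i1, hi1, hmax⟩ := Finset.exists_max_image _ g hne
      have hi1' : g i1 < g i0 := by simpa using hi1
      have hn : i1 ∉ T := fun hh => absurd (hmin i1 hh) (not_le.2 hi1')
      have heq : (Finset.univ.filter (fun i' => g i' < g i0))
          = (Finset.univ.filter (fun i' => g i' ≤ g i1)) := by
        ext i
        simp only [Finset.mem_filter, Finset.mem_univ, true_and]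
        exact ⟨fun hi => hmax i (by simpa using hi), fun hi => lt_of_le_of_lt hi hi1'⟩
      rw [heq]
      simpa [hT] using hn
  have hcardm : (Finset.univ.filter (fun i' => g i' ≤ g i0)).card
      = (Finset.univ.filter (fun i' => g i' < g i0)).card + 1 := by
    have : (Finset.univ.filter (fun i' => g i' ≤ g i0))
        = insert i0 (Finset.univ.filter (fun i' => g i' < g i0)) := by
      ext i
      simp only [Finset.mem_filter, Finset.mem_univ, true_and, Finset.mem_insert]
      rw [le_iff_lt_or_eq, or_comm, hg.eq_iff]
    rw [this, Finset.card_insert_of_notMem (by simp)]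
  set m := (Finset.univ.filter (fun i' => g i' < g i0)).card with hm
  set k := (Finset.univ.filter (fun j => h j < g i0)).card with hk
  set s : Finset ℝ := Finset.univ.image g ∪ Finset.univ.image h with hs
  have hgs : ∀ i, g i ∈ s := fun i => by simp [hs]
  have hhs : ∀ j, h j ∈ s := fun j => by simp [hs]
  rw [hcardm] at hle
  by_cases hkq : 2 * k ≤ q
  · obtain ⟨c, hc, hcs⟩ := exists_above s (g i0)
    have hg1 : ∀ i, g i < c ↔ g i ≤ g i0 := fun i =>
      ⟨fun hi => by by_contra hcon; exact lt_asymm hi (hcs _ (hgs i) (not_le.1 hcon)),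
        fun hi => lt_of_le_of_lt hi hc⟩
    have hh1 : ∀ j, h j < c ↔ h j < g i0 := fun j =>
      ⟨fun hi => by
        by_contra hcon
        exact lt_asymm hi (hcs _ (hhs j) (lt_of_le_of_ne (not_lt.1 hcon) (hgh i0 j))),
        fun hi => hi.trans hc⟩
    have hg2 : ∀ i, g i ≠ c := fun i hi => by
      have := hcs _ (hgs i) (hi ▸ hc)
      exact absurd hi this.ne'
    have hh2 : ∀ j, h j ≠ c := fun i hi => by
      have := hcs _ (hhs i) (hi ▸ hc)
      exact absurd hi this.ne'
    refine ⟨c, hg2, hh2, ?_⟩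
    have := card_sep g h c hg2 hh2 (m + 1) k (by simp only [hg1, hcardm]) (by simp only [hh1, hk])
    zify
    rw [this]
    push_cast
    zify at hle hkq
    nlinarith [mul_nonneg (sub_nonneg.2 hle) (sub_nonneg.2 hkq)]
  · obtain ⟨c, hc, hcs⟩ := exists_below s (g i0)
    have hg1 : ∀ i, g i < c ↔ g i < g i0 := fun i =>
      ⟨fun hi => hi.trans hc, fun hi => hcs _ (hgs i) hi⟩
    have hh1 : ∀ j, h j < c ↔ h j < g i0 := fun j =>
      ⟨fun hi => hi.trans hc, fun hi => hcs _ (hhs j) hi⟩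
    have hg2 : ∀ i, g i ≠ c := fun i hi => by
      have := hcs _ (hgs i) (hi ▸ hc)
      exact absurd hi this.ne
    have hh2 : ∀ j, h j ≠ c := fun i hi => by
      have := hcs _ (hhs i) (hi ▸ hc)
      exact absurd hi this.ne
    refine ⟨c, hg2, hh2, ?_⟩
    have := card_sep g h c hg2 hh2 m k (by simp only [hg1, hm]) (by simp only [hh1, hk])
    zify
    rw [this]
    push_cast
    zify at hlt hkq
    nlinarith [mul_nonneg (sub_nonneg.2 hlt.le) (sub_nonneg.2 (not_le.1 hkq).le)]

/-- A circle with three distinct points in a level set of a linear functional lies in it. -/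
lemma circle_in_plane {C : Set (EuclideanSpace ℝ (Fin 3))} (hC : IsCircle 3 C)
    (f : EuclideanSpace ℝ (Fin 3) →ₗ[ℝ] ℝ) (c : ℝ) {x y z : EuclideanSpace ℝ (Fin 3)}
    (hx : x ∈ C) (hy : y ∈ C) (hz : z ∈ C) (hxy : x ≠ y) (hxz : x ≠ z) (hyz : y ≠ z)
    (fx : f x = c) (fy : f y = c) (fz : f z = c) : ∀ w ∈ C, f w = c := by
  obtain ⟨P, o, r, hfin, -, hr, rfl⟩ := hC
  have hco : EuclideanGeometry.Cospherical ({x, y, z} : Set (EuclideanSpace ℝ (Fin 3))) := by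
    refine ⟨o, r, ?_⟩
    rintro w (rfl | rfl | rfl)
    exacts [hx.2, hy.2, hz.2]
  have hai := hco.affineIndependent_of_ne hxy hxz hyz
  have hle : affineSpan ℝ (Set.range ![x, y, z]) ≤ P := by
    rw [affineSpan_le]
    rintro w ⟨i, rfl⟩
    fin_cases i
    exacts [hx.1, hy.1, hz.1]
  have heq := hai.affineSpan_eq_of_le_of_card_eq_finrank_add_one hle (by simp [hfin])
  set Pl : AffineSubspace ℝ (EuclideanSpace ℝ (Fin 3)) :=
    (AffineSubspace.mk' c ⊥).comap f.toAffineMap with hPl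
  have hmem : ∀ w, w ∈ Pl ↔ f w = c := by
    intro w
    simp [hPl, AffineSubspace.mem_comap, AffineSubspace.mem_mk', sub_eq_zero]
  have hle2 : affineSpan ℝ (Set.range ![x, y, z]) ≤ Pl := by
    rw [affineSpan_le]
    rintro w ⟨i, rfl⟩
    fin_cases i
    exacts [(hmem _).2 fx, (hmem _).2 fy, (hmem _).2 fz]
  intro w hw
  rw [← hmem]
  exact hle2 (heq ▸ hw.1)

/-- For all positive integers `p` and `q`, every crossing-free circular-arc drawing of the
complete bipartite graph `K_{p,q}` in `ℝ³` covered by a family of `r` circles satisfies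
`r ≥ ⌈pq/4⌉`. -/
theorem completeBipartiteGraph_circle_cover_lower_bound (p q : ℕ) (hp : 0 < p) (hq : 0 < q)
    (D : CircularArcDrawing 3 (completeBipartiteGraph (Fin p) (Fin q)))
    (𝒞 : Finset (Set (EuclideanSpace ℝ (Fin 3))))
    (hcirc : ∀ C ∈ 𝒞, IsCircle 3 C) (hcov : D.CoveredBy 𝒞)
    (r : ℕ) (hr : 𝒞.card = r) :
    (p * q + 3) / 4 ≤ r := by
  obtain ⟨f, hf⟩ : ∃ f : EuclideanSpace ℝ (Fin 3) →ₗ[ℝ] ℝ,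
      ∀ u v, u ≠ v → f (D.pos u) ≠ f (D.pos v) := by
    obtain ⟨f, hf⟩ := Module.exists_dual_forall_apply_ne_zero (K := ℝ)
      (ι := {e : (Fin p ⊕ Fin q) × (Fin p ⊕ Fin q) // e.1 ≠ e.2})
      (fun e => D.pos e.1.1 - D.pos e.1.2)
      (fun e => sub_ne_zero.2 (fun h => e.2 (D.inj h)))
    refine ⟨f, fun u v huv h => hf ⟨(u, v), huv⟩ ?_⟩
    simp [h]
  obtain ⟨c, hgc, hhc, hcard⟩ := exists_threshold hp (fun i => f (D.pos (Sum.inl i)))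
    (fun j => f (D.pos (Sum.inr j)))
    (fun i i' h => by
      by_contra hne
      exact hf _ _ (fun h' => hne (Sum.inl_injective h')) h)
    (fun i j => hf _ _ (by simp))
  have hvc : ∀ v, f (D.pos v) ≠ c := by
    rintro (i | j)
    exacts [hgc i, hhc j]
  set Ed := Finset.univ.filter (fun e : Fin p × Fin q =>
      (f (D.pos (Sum.inl e.1)) < c ∧ c < f (D.pos (Sum.inr e.2))) ∨
      (f (D.pos (Sum.inr e.2)) < c ∧ c < f (D.pos (Sum.inl e.1)))) with hEd
  let ed : Fin p × Fin q → Sym2 (Fin p ⊕ Fin q) := fun e => s(Sum.inl e.1, Sum.inr e.2)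
  have hed : ∀ e, ed e ∈ (completeBipartiteGraph (Fin p) (Fin q)).edgeSet := by
    intro e
    simp [ed]
  have hedinj : ∀ e e', ed e = ed e' → e = e' := by
    rintro ⟨i, j⟩ ⟨i', j'⟩ h
    simpa [ed] using h
  have hfc : Continuous f := f.continuous_of_finiteDimensional
  have hX : ∀ e ∈ Ed, ∃ x ∈ D.arc (ed e), f x = c := by
    intro e he
    obtain ⟨C, -, -, -, hconn⟩ := D.arc_isArc _ (hed e)
    have ha := D.endpoint_mem _ (hed e) (Sum.inl e.1) (by simp [ed])
    have hb := D.endpoint_mem _ (hed e) (Sum.inr e.2) (by simp [ed])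
    simp only [hEd, Finset.mem_filter, Finset.mem_univ, true_and] at he
    rcases he with he | he
    · exact hconn.isPreconnected.intermediate_value ha hb hfc.continuousOn ⟨he.1.le, he.2.le⟩
    · exact hconn.isPreconnected.intermediate_value hb ha hfc.continuousOn ⟨he.1.le, he.2.le⟩
  choose! X hXa hXc using hX
  choose Ci hCi hCa using fun e => hcov _ (hed e)
  have hXinj : ∀ e ∈ Ed, ∀ e' ∈ Ed, e ≠ e' → X e ≠ X e' := by
    intro e he e' he' hne h
    have h1 : X e ∈ D.arc (ed e) ∩ D.arc (ed e') := ⟨hXa e he, h ▸ hXa e' he'⟩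
    rw [D.crossFree _ (hed e) _ (hed e') (fun h => hne (hedinj _ _ h))] at h1
    obtain ⟨w, -, hw⟩ := h1
    exact hvc w (hw ▸ hXc e he)
  have hcount : Ed.card ≤ 2 * 𝒞.card := by
    refine Finset.card_le_mul_card_image_of_maps_to (f := Ci) (fun e _ => hCi e) 2 ?_
    intro C hC
    by_contra hcon
    obtain ⟨e1, e2, e3, h1, h2, h3, h12, h13, h23⟩ := Finset.two_lt_card_iff.1 (not_le.1 hcon)
    simp only [Finset.mem_filter] at h1 h2 h3
    have hall := circle_in_plane (hcirc C hC) f c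
      (h1.2 ▸ hCa e1 (hXa e1 h1.1)) (h2.2 ▸ hCa e2 (hXa e2 h2.1)) (h3.2 ▸ hCa e3 (hXa e3 h3.1))
      (hXinj e1 h1.1 e2 h2.1 h12) (hXinj e1 h1.1 e3 h3.1 h13) (hXinj e2 h2.1 e3 h3.1 h23)
      (hXc e1 h1.1) (hXc e2 h2.1) (hXc e3 h3.1)
    exact hvc (Sum.inl e1.1) (hall _ (h1.2 ▸ hCa e1
      (D.endpoint_mem _ (hed e1) (Sum.inl e1.1) (by simp [ed]))))
  rw [← hr]
  omega
end
end

section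
/- Let G be a finite simple graph that admits a k-page book embedding, that is, a linear order ≺ on V(G) together with a partition of the edge set E(G) into k pages such that no two edges uv and xy (with u ≺ v, x ≺ y) on the same page interleave, i.e., u ≺ x ≺ v ≺ y never occurs. Then G admits a crossing-free circular-arc drawing in ℝ³ all of whose arcs are contained in the union of ⌈k/2⌉ spheres in ℝ³. -/
open Set

noncomputable section

/-- Rational parametrization of the unit circle. -/
def cP (a : ℝ) : E3 := !₂[(1 - a ^ 2) / (1 + a ^ 2), 2 * a / (1 + a ^ 2), 0]

/-- The chord equation. -/
def cL (a b : ℝ) (q : E3) : ℝ := (1 - a * b) * q 0 + (a + b) * q 1 - (1 + a * b)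

/-- Inverse stereographic projection from `(0,0,h)`. -/
def cF (h : ℝ) (q : E3) : E3 :=
  !₂[(1 + h ^ 2) / (q 0 ^ 2 + q 1 ^ 2 + h ^ 2) * q 0,
     (1 + h ^ 2) / (q 0 ^ 2 + q 1 ^ 2 + h ^ 2) * q 1,
     h * (q 0 ^ 2 + q 1 ^ 2 - 1) / (q 0 ^ 2 + q 1 ^ 2 + h ^ 2)]

@[simp] lemma cP0 (a : ℝ) : cP a 0 = (1 - a ^ 2) / (1 + a ^ 2) := rfl
@[simp] lemma cP1 (a : ℝ) : cP a 1 = 2 * a / (1 + a ^ 2) := rfl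
@[simp] lemma cP2 (a : ℝ) : cP a 2 = 0 := rfl
lemma cF0 (h : ℝ) (q : E3) : cF h q 0 = (1 + h ^ 2) / (q 0 ^ 2 + q 1 ^ 2 + h ^ 2) * q 0 := rfl
lemma cF1 (h : ℝ) (q : E3) : cF h q 1 = (1 + h ^ 2) / (q 0 ^ 2 + q 1 ^ 2 + h ^ 2) * q 1 := rfl
lemma cF2 (h : ℝ) (q : E3) :
    cF h q 2 = h * (q 0 ^ 2 + q 1 ^ 2 - 1) / (q 0 ^ 2 + q 1 ^ 2 + h ^ 2) := rfl

lemma E3ext {x y : E3} (h0 : x 0 = y 0) (h1 : x 1 = y 1) (h2 : x 2 = y 2) : x = y := by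
  ext i
  fin_cases i
  · exact h0
  · exact h1
  · exact h2

lemma cP_norm (a : ℝ) : cP a 0 ^ 2 + cP a 1 ^ 2 = 1 := by
  have : (1 + a ^ 2) ≠ 0 := by positivity
  simp only [cP0, cP1]
  field_simp
  ring

lemma cL_cP (a b c : ℝ) : cL a b (cP c) = -2 * ((c - a) * (c - b)) / (1 + c ^ 2) := by
  have : (1 + c ^ 2) ≠ 0 := by positivity
  simp only [cL, cP0, cP1]
  field_simp
  ring

lemma cP_inj : Function.Injective cP := by
  intro a b h
  have h1 := cL_cP a a a
  rw [h, cL_cP, sub_self, zero_mul, mul_zero, zero_div] at h1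
  have h2 : (1 + b ^ 2) ≠ 0 := by positivity
  have h3 := (div_eq_zero_iff.1 h1).resolve_right h2
  have h4 : (b - a) * (b - a) = 0 := by linarith
  have := mul_self_eq_zero.1 h4
  linarith

lemma cL_comb (a b s t : ℝ) (hst : s + t = 1) (x y : E3) :
    cL a b (s • x + t • y) = s * cL a b x + t * cL a b y := by
  simp only [cL, PiLp.add_apply, PiLp.smul_apply, smul_eq_mul]
  linear_combination (1 + a * b) * hst

lemma seg_props {a b : ℝ} {q : E3} (hq : q ∈ segment ℝ (cP a) (cP b)) :
    q 0 ^ 2 + q 1 ^ 2 ≤ 1 ∧ q 2 = 0 ∧ cL a b q = 0 ∧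
      (q 0 ^ 2 + q 1 ^ 2 = 1 → q = cP a ∨ q = cP b) := by
  obtain ⟨s, t, hs, ht, hst, rfl⟩ := hq
  have key : (s • cP a + t • cP b) 0 ^ 2 + (s • cP a + t • cP b) 1 ^ 2
      = 1 - s * t * ((cP a 0 - cP b 0) ^ 2 + (cP a 1 - cP b 1) ^ 2) := by
    simp only [PiLp.add_apply, PiLp.smul_apply, smul_eq_mul]
    have h1 := cP_norm a
    have h2 := cP_norm b
    obtain rfl : t = 1 - s := by linarith
    linear_combination (s ^ 2 + s * (1 - s)) * h1 + ((1 - s) ^ 2 + s * (1 - s)) * h2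
  refine ⟨?_, ?_, ?_, ?_⟩
  · rw [key]
    have : 0 ≤ s * t * ((cP a 0 - cP b 0) ^ 2 + (cP a 1 - cP b 1) ^ 2) := by positivity
    linarith
  · simp
  · rw [cL_comb _ _ _ _ hst, cL_cP, cL_cP]; simp
  · intro h
    rw [key] at h
    have h3 : s * t * ((cP a 0 - cP b 0) ^ 2 + (cP a 1 - cP b 1) ^ 2) = 0 := by linarith
    rcases mul_eq_zero.1 h3 with h4 | h4
    · rcases mul_eq_zero.1 h4 with rfl | rfl
      · right
        obtain rfl : t = 1 := by linarith
        simp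
      · left
        obtain rfl : s = 1 := by linarith
        simp
    · left
      have e0 : cP a 0 = cP b 0 := by nlinarith [sq_nonneg (cP a 0 - cP b 0), sq_nonneg (cP a 1 - cP b 1)]
      have e1 : cP a 1 = cP b 1 := by nlinarith [sq_nonneg (cP a 0 - cP b 0), sq_nonneg (cP a 1 - cP b 1)]
      have : cP a = cP b := E3ext e0 e1 rfl
      rw [← this, ← add_smul, hst, one_smul]

/-- Non-interleaving chords meet only in common endpoints. -/
lemma chords_meet {a b c d : ℝ} (hab : a < b) (hcd : c < d)
    (h1 : ¬ (a < c ∧ c < b ∧ b < d)) (h2 : ¬ (c < a ∧ a < d ∧ d < b))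
    (hne : ¬ (a = c ∧ b = d)) {q : E3}
    (hq : q ∈ segment ℝ (cP a) (cP b)) (hq' : q ∈ segment ℝ (cP c) (cP d)) :
    (q = cP c ∧ (c = a ∨ c = b)) ∨ (q = cP d ∧ (d = a ∨ d = b)) := by
  have hL := (seg_props hq).2.2.1
  obtain ⟨s, t, hs, ht, hst, rfl⟩ := hq'
  rw [cL_comb _ _ _ _ hst] at hL
  have sgn : (0 ≤ cL a b (cP c) ∧ 0 ≤ cL a b (cP d)) ∨ (cL a b (cP c) ≤ 0 ∧ cL a b (cP d) ≤ 0) := by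
    rw [cL_cP, cL_cP]
    have pos : ∀ x, a ≤ x → x ≤ b → 0 ≤ -2 * ((x - a) * (x - b)) / (1 + x ^ 2) := by
      intro x h h'
      apply div_nonneg _ (by positivity)
      nlinarith
    have neg : ∀ x, ¬ (a < x ∧ x < b) → -2 * ((x - a) * (x - b)) / (1 + x ^ 2) ≤ 0 := by
      intro x h
      apply div_nonpos_of_nonpos_of_nonneg _ (by positivity)
      by_cases h' : x ≤ a
      · nlinarith
      · have : b ≤ x := by
          by_contra h3
          exact h ⟨not_le.1 h', not_le.1 h3⟩
        nlinarith
    by_cases hc : a < c ∧ c < b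
    · left
      exact ⟨pos c hc.1.le hc.2.le, pos d (hc.1.trans hcd).le
        (not_lt.1 fun h => h1 ⟨hc.1, hc.2, h⟩)⟩
    · by_cases hd : a < d ∧ d < b
      · left
        exact ⟨pos c (not_lt.1 fun h => h2 ⟨h, hd.1, hd.2⟩) (hcd.trans hd.2).le,
          pos d hd.1.le hd.2.le⟩
      · right
        exact ⟨neg c hc, neg d hd⟩
  have z : s * cL a b (cP c) = 0 ∧ t * cL a b (cP d) = 0 := by
    rcases sgn with ⟨h, h'⟩ | ⟨h, h'⟩
    · have := mul_nonneg hs h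
      have := mul_nonneg ht h'
      constructor <;> linarith
    · have := mul_nonpos_of_nonneg_of_nonpos hs h
      have := mul_nonpos_of_nonneg_of_nonpos ht h'
      constructor <;> linarith
  have zero : ∀ x, cL a b (cP x) = 0 → x = a ∨ x = b := by
    intro x hx
    rw [cL_cP] at hx
    have : (1 + x ^ 2) ≠ 0 := by positivity
    rcases div_eq_zero_iff.1 hx with h | h
    · have : (x - a) * (x - b) = 0 := by linarith
      rcases mul_eq_zero.1 this with h | h
      · left; linarith
      · right; linarith
    · exact absurd h this
  rcases eq_or_ne s 0 with rfl | hs0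
  · obtain rfl : t = 1 := by linarith
    right
    refine ⟨by simp, zero d (by simpa using z.2)⟩
  · have hc := zero c ((mul_eq_zero.1 z.1).resolve_left hs0)
    rcases eq_or_ne t 0 with rfl | ht0
    · obtain rfl : s = 1 := by linarith
      left
      exact ⟨by simp, hc⟩
    · have hd := zero d ((mul_eq_zero.1 z.2).resolve_left ht0)
      exfalso
      rcases hc with rfl | rfl <;> rcases hd with rfl | rfl
      · exact lt_irrefl _ hcd
      · exact hne ⟨rfl, rfl⟩
      · exact lt_asymm hab hcd
      · exact lt_irrefl _ hcd

lemma cF_den {h : ℝ} (hh : h ≠ 0) (q : E3) : 0 < q 0 ^ 2 + q 1 ^ 2 + h ^ 2 := by positivity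

lemma cF_cont {h : ℝ} (hh : h ≠ 0) : Continuous (cF h) := by
  have hd : ∀ q : E3, q 0 ^ 2 + q 1 ^ 2 + h ^ 2 ≠ 0 := fun q => (cF_den hh q).ne'
  have hc : ∀ i, Continuous fun q : E3 => q i := fun i => by fun_prop
  have h0 := hc 0
  have h1 := hc 1
  unfold cF
  refine (PiLp.continuous_toLp 2 _).comp (continuous_pi fun i => ?_)
  fin_cases i
  · exact Continuous.mul (Continuous.div (by fun_prop) (by fun_prop) hd) h0
  · exact Continuous.mul (Continuous.div (by fun_prop) (by fun_prop) hd) h1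
  · exact Continuous.div (by fun_prop) (by fun_prop) hd

lemma cF_fix {h : ℝ} {q : E3} (h1 : q 0 ^ 2 + q 1 ^ 2 = 1) (h2 : q 2 = 0) : cF h q = q := by
  have : (1 + h ^ 2) ≠ 0 := by positivity
  apply E3ext
  · rw [cF0, h1, div_self this, one_mul]
  · rw [cF1, h1, div_self this, one_mul]
  · rw [cF2, h1, h2]; simp

lemma cF_cP (h a : ℝ) : cF h (cP a) = cP a := cF_fix (cP_norm a) rfl

lemma cF_z {h : ℝ} (hh : h ≠ 0) {q : E3} (hz : cF h q 2 = 0) : q 0 ^ 2 + q 1 ^ 2 = 1 := by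
  have := (cF_den hh q).ne'
  rw [cF2] at hz
  rcases div_eq_zero_iff.1 hz with h' | h'
  · rcases mul_eq_zero.1 h' with h' | h'
    · exact absurd h' hh
    · linarith
  · exact absurd h' this

lemma cF_sign {h : ℝ} (hh : h ≠ 0) {q : E3} (hq : q 0 ^ 2 + q 1 ^ 2 ≤ 1) : h * cF h q 2 ≤ 0 := by
  have := (cF_den hh q)
  rw [cF2, ← mul_div_assoc]
  apply div_nonpos_of_nonpos_of_nonneg _ this.le
  nlinarith [sq_nonneg h]

lemma cF_sphere {h : ℝ} (hh : h ≠ 0) (q : E3) :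
    cF h q 0 ^ 2 + cF h q 1 ^ 2 + cF h q 2 ^ 2 = 1 + (h - 1 / h) * cF h q 2 := by
  have := (cF_den hh q).ne'
  rw [cF0, cF1, cF2]
  field_simp
  ring

lemma cF_inj {h : ℝ} (hh : h ≠ 0) {q q' : E3} (h2 : q 2 = q' 2) (he : cF h q = cF h q') :
    q = q' := by
  have d := (cF_den hh q).ne'
  have d' := (cF_den hh q').ne'
  have e0 : cF h q 0 = cF h q' 0 := by rw [he]
  have e1 : cF h q 1 = cF h q' 1 := by rw [he]
  have e2 : cF h q 2 = cF h q' 2 := by rw [he]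
  have hk : (1 + h ^ 2) ≠ 0 := by positivity
  have hD : q 0 ^ 2 + q 1 ^ 2 + h ^ 2 = q' 0 ^ 2 + q' 1 ^ 2 + h ^ 2 := by
    rw [cF2, cF2, div_eq_div_iff d d'] at e2
    have : h * (1 + h ^ 2) * ((q 0 ^ 2 + q 1 ^ 2 + h ^ 2) - (q' 0 ^ 2 + q' 1 ^ 2 + h ^ 2)) = 0 := by
      linear_combination e2
    have := (mul_eq_zero.1 this).resolve_left (mul_ne_zero hh hk)
    linarith
  rw [cF0, cF0, hD] at e0
  rw [cF1, cF1, hD] at e1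
  exact E3ext (mul_left_cancel₀ (div_ne_zero hk d') e0) (mul_left_cancel₀ (div_ne_zero hk d') e1) h2

lemma cF_cross {h h' : ℝ} (hh : h ≠ 0) (hh' : h' ≠ 0) (hne : h ≠ h') {q q' : E3}
    (hq : q 0 ^ 2 + q 1 ^ 2 ≤ 1) (hq' : q' 0 ^ 2 + q' 1 ^ 2 ≤ 1) (he : cF h q = cF h' q') :
    cF h q 2 = 0 := by
  by_contra hz
  have s1 := cF_sphere hh q
  have s2 := cF_sphere hh' q'
  have g1 := cF_sign hh hq
  have g2 := cF_sign hh' hq'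
  rw [← he] at s2 g2
  have hm : h - 1 / h = h' - 1 / h' := mul_right_cancel₀ hz (by linarith)
  field_simp at hm
  have h3 : (h - h') * (h * h' + 1) = 0 := by linear_combination hm
  have h4 : h * h' + 1 = 0 := (mul_eq_zero.1 h3).resolve_left (sub_ne_zero.2 hne)
  have h5 := mul_nonneg_of_nonpos_of_nonpos g1 g2
  have h6 : 0 < (cF h q 2) ^ 2 := by positivity
  nlinarith

/-- The sphere of the pencil with parameter `m`. -/
def cS (m : ℝ) : Set E3 := {x | x 0 ^ 2 + x 1 ^ 2 + x 2 ^ 2 = 1 + m * x 2}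

lemma cS_eq (m : ℝ) : cS m = Metric.sphere (!₂[0, 0, m / 2] : E3) (√(1 + (m / 2) ^ 2)) := by
  ext x
  rw [Metric.mem_sphere, EuclideanSpace.dist_eq, Real.sqrt_inj (by positivity) (by positivity)]
  simp only [cS, Set.mem_ofPred_eq, Fin.sum_univ_three, Real.dist_eq, sq_abs]
  simp
  constructor <;> intro h <;> linear_combination h

lemma cS_isSphere (m : ℝ) : IsSphereDim 3 2 (cS m) := by
  refine ⟨⊤, !₂[0, 0, m / 2], √(1 + (m / 2) ^ 2), ?_, trivial, by positivity, ?_⟩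
  · rw [AffineSubspace.direction_top, finrank_top]
    simp
  · rw [cS_eq]
    ext x
    exact ⟨fun h => ⟨trivial, h⟩, fun h => h.2⟩

lemma circle_of_plane {n p0 c : E3} {R : ℝ} (hn : n ≠ 0) {A : Set E3}
    (hA : ∀ x ∈ A, inner ℝ n (x - p0) = 0) (hS : A ⊆ Metric.sphere c R)
    {x y : E3} (hx : x ∈ A) (hy : y ∈ A) (hxy : x ≠ y) :
    ∃ C, IsCircle 3 C ∧ A ⊆ C := by
  let Pl : AffineSubspace ℝ E3 := AffineSubspace.mk' p0 (Submodule.span ℝ {n})ᗮ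
  have hmem : ∀ z ∈ A, z ∈ Pl := by
    intro z hz
    rw [AffineSubspace.mem_mk', Submodule.mem_orthogonal_singleton_iff_inner_right]
    exact hA z hz
  have : Nonempty Pl := ⟨⟨x, hmem x hx⟩⟩
  let o : E3 := (EuclideanGeometry.orthogonalProjection Pl c : E3)
  have ho : o ∈ Pl := EuclideanGeometry.orthogonalProjection_mem c
  have hd : ∀ z ∈ A, dist z o = dist x o := by
    have pyth : ∀ z ∈ A, dist z o * dist z o = R * R - dist c o * dist c o := by
      intro z hz
      have h := EuclideanGeometry.dist_sq_eq_dist_orthogonalProjection_sq_add_dist_orthogonalProjection_sq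
        (s := Pl) c (hmem z hz)
      have h2 : dist z c = R := hS hz
      rw [h2] at h
      change R * R = dist z o * dist z o + dist c o * dist c o at h
      linarith
    intro z hz
    have := (pyth z hz).trans (pyth x hx).symm
    exact (mul_self_inj dist_nonneg dist_nonneg).1 this
  refine ⟨{z | z ∈ Pl ∧ dist z o = dist x o}, ⟨Pl, o, dist x o, ?_, ho, ?_, rfl⟩,
    fun z hz => ⟨hmem z hz, hd z hz⟩⟩
  · rw [AffineSubspace.direction_mk']
    have : Fact (Module.finrank ℝ E3 = 1 + 1 + 1) := ⟨by simp⟩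
    exact Submodule.finrank_orthogonal_span_singleton hn
  · rcases dist_nonneg.lt_or_eq (a := (0 : ℝ)) (b := dist x o) with h | h
    · exact h
    · exfalso
      have h1 := hd y hy
      rw [← h] at h1
      exact hxy ((dist_eq_zero.1 h.symm).trans (dist_eq_zero.1 h1).symm)

lemma arc_ok {h a b : ℝ} (hh : h ≠ 0) (hab : a ≠ b) :
    IsArc 3 (cF h '' segment ℝ (cP a) (cP b)) := by
  have hcomp : IsCompact (segment ℝ (cP a) (cP b)) := by
    rw [segment_eq_image]
    exact isCompact_Icc.image (by fun_prop)
  have hconn : IsConnected (segment ℝ (cP a) (cP b)) :=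
    ((convex_segment _ _).isConnected ⟨_, left_mem_segment ℝ _ _⟩)
  have hc := cF_cont hh
  have hS : cF h '' segment ℝ (cP a) (cP b) ⊆ cS (h - 1 / h) := by
    rintro _ ⟨q, -, rfl⟩
    exact cF_sphere hh q
  rw [cS_eq] at hS
  have hn : (!₂[1 - a * b, a + b, (1 + a * b) / h] : E3) ≠ 0 := by
    intro h0
    have e0 : 1 - a * b = 0 := congrArg (fun v : E3 => v 0) h0
    have e2 : (1 + a * b) / h = 0 := congrArg (fun v : E3 => v 2) h0
    have := (div_eq_zero_iff.1 e2).resolve_right hh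
    linarith
  obtain ⟨C, hC, hAC⟩ := circle_of_plane (p0 := !₂[0, 0, h]) hn (A := cF h '' segment ℝ (cP a) (cP b))
    (by
      rintro _ ⟨q, hq, rfl⟩
      have hL := (seg_props hq).2.2.1
      have d := (cF_den hh q).ne'
      simp only [PiLp.inner_apply, Fin.sum_univ_three, PiLp.sub_apply, cF0, cF1, cF2]
      simp
      unfold cL at hL
      field_simp
      linear_combination (1 + h ^ 2) * hL) hS
    (x := cP a) (y := cP b) ⟨cP a, left_mem_segment ℝ _ _, cF_cP h a⟩
    ⟨cP b, right_mem_segment ℝ _ _, cF_cP h b⟩ (fun h => hab (cP_inj h))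
  exact ⟨C, hC, hAC, hcomp.image hc, hconn.image _ hc.continuousOn⟩

/-- Pole height of page `j`. -/
def hpar (j : ℕ) : ℝ := if j % 2 = 0 then ((j / 2 : ℕ) : ℝ) + 1 else -1 / (((j / 2 : ℕ) : ℝ) + 1)

lemma hpar_ne (j : ℕ) : hpar j ≠ 0 := by
  unfold hpar
  have : (((j / 2 : ℕ) : ℝ) + 1) ≠ 0 := by positivity
  split_ifs
  · exact this
  · exact div_ne_zero (by norm_num) this

lemma hpar_inj : Function.Injective hpar := by
  intro i j h
  unfold hpar at h
  have hi : 0 < (((i / 2 : ℕ) : ℝ) + 1) := by positivity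
  have hj : 0 < (((j / 2 : ℕ) : ℝ) + 1) := by positivity
  have hi' : -1 / (((i / 2 : ℕ) : ℝ) + 1) < 0 := div_neg_of_neg_of_pos (by norm_num) hi
  have hj' : -1 / (((j / 2 : ℕ) : ℝ) + 1) < 0 := div_neg_of_neg_of_pos (by norm_num) hj
  split_ifs at h with h1 h2 h2
  · have : ((i / 2 : ℕ) : ℝ) = ((j / 2 : ℕ) : ℝ) := by linarith
    have := Nat.cast_injective this
    omega
  · linarith
  · linarith
  · rw [div_eq_div_iff hi.ne' hj.ne'] at h
    have : ((i / 2 : ℕ) : ℝ) = ((j / 2 : ℕ) : ℝ) := by linarith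
    have := Nat.cast_injective this
    omega

lemma hpar_m (j : ℕ) :
    hpar j - 1 / hpar j = (((j / 2 : ℕ) : ℝ) + 1) - 1 / (((j / 2 : ℕ) : ℝ) + 1) := by
  unfold hpar
  have : (((j / 2 : ℕ) : ℝ) + 1) ≠ 0 := by positivity
  split_ifs
  · rfl
  · field_simp
    ring

/-- The chord of an edge. -/
def chord {V : Type*} (ord : V → ℕ) : Sym2 V → Set E3 :=
  Sym2.lift ⟨fun a b => segment ℝ (cP (ord a)) (cP (ord b)), fun _ _ => segment_symm ℝ _ _⟩

lemma chord_mk {V : Type*} (ord : V → ℕ) (a b : V) :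
    chord ord s(a, b) = segment ℝ (cP (ord a)) (cP (ord b)) := rfl

lemma chord_props {V : Type*} (ord : V → ℕ) (e : Sym2 V) {q : E3} (hq : q ∈ chord ord e) :
    q 0 ^ 2 + q 1 ^ 2 ≤ 1 ∧ q 2 = 0 ∧ 
      (q 0 ^ 2 + q 1 ^ 2 = 1 → ∃ w ∈ e, q = cP (ord w)) := by
  induction e with
  | _ a b =>
    obtain ⟨h1, h2, -, h3⟩ := seg_props hq
    refine ⟨h1, h2, fun h => ?_⟩
    rcases h3 h with h | h
    · exact ⟨a, by simp, h⟩
    · exact ⟨b, by simp, h⟩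

lemma edge_sorted {V : Type*} (G : SimpleGraph V) (ord : V → ℕ) (hord : Function.Injective ord)
    (e : Sym2 V) (he : e ∈ G.edgeSet) : ∃ a b, e = s(a, b) ∧ G.Adj a b ∧ ord a < ord b := by
  induction e with
  | _ a b =>
    rw [SimpleGraph.mem_edgeSet] at he
    rcases lt_or_gt_of_ne (fun h => he.ne (hord h)) with h | h
    · exact ⟨a, b, rfl, he, h⟩
    · exact ⟨b, a, Sym2.eq_swap, he.symm, h⟩

/-- If a finite simple graph `G` admits a `k`-page book embedding — a linear order on the
vertices (given by an injection `ord : V → ℕ`) together with an assignment of each edge to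
one of `k` pages such that no two edges on the same page interleave — then `G` admits a
crossing-free circular-arc drawing in `ℝ³` all of whose arcs are contained in the union of
`⌈k/2⌉` spheres in `ℝ³`. -/
theorem bookEmbedding_to_sphere_cover {V : Type*} [Fintype V] (G : SimpleGraph V) (k : ℕ)
    (ord : V → ℕ) (hord : Function.Injective ord)
    (page : Sym2 V → Fin k)
    (hpage : ∀ u v x y : V, G.Adj u v → G.Adj x y →
      page s(u, v) = page s(x, y) → ord u < ord v → ord x < ord y →
      ¬(ord u < ord x ∧ ord x < ord v ∧ ord v < ord y)) :
    ∃ (D : CircularArcDrawing 3 G) (𝒮 : Finset (Set (EuclideanSpace ℝ (Fin 3)))),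
      (∀ S ∈ 𝒮, IsSphereDim 3 2 S) ∧ 𝒮.card ≤ (k + 1) / 2 ∧
      ∀ e ∈ G.edgeSet, D.arc e ⊆ ⋃ S ∈ 𝒮, S := by
  have pinj : Function.Injective fun v => cP (ord v : ℝ) :=
    fun u v h => hord (Nat.cast_injective (cP_inj h))
  have endp : ∀ e : Sym2 V, ∀ v ∈ e, cP (ord v) ∈ cF (hpar (page e)) '' chord ord e := by
    intro e v hv
    refine ⟨cP (ord v), ?_, cF_cP _ _⟩
    induction e with
    | _ a b =>
      rcases Sym2.mem_iff.1 hv with rfl | rfl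
      · exact left_mem_segment ℝ _ _
      · exact right_mem_segment ℝ _ _
  refine ⟨{ pos := fun v => cP (ord v)
            inj := pinj
            arc := fun e => cF (hpar (page e)) '' chord ord e
            arc_isArc := ?_
            endpoint_mem := fun e _ => endp e
            crossFree := ?_
            vertex_mem := ?_ },
    by
      classical
      exact (Finset.range ((k + 1) / 2)).image
        fun i : ℕ => cS (((i : ℝ) + 1) - 1 / ((i : ℝ) + 1)), ?_, ?_, ?_⟩
  · intro e he
    obtain ⟨a, b, rfl, -, hab⟩ := edge_sorted G ord hord e he
    exact arc_ok (hpar_ne _) (by exact_mod_cast hab.ne)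
  · intro e he f hf hef
    apply Set.Subset.antisymm
    · rintro X ⟨⟨q, hq, rfl⟩, ⟨q', hq', hX⟩⟩
      obtain ⟨a1, a2, a3⟩ := chord_props ord e hq
      obtain ⟨b1, b2, b3⟩ := chord_props ord f hq'
      by_cases hp : page e = page f
      · rw [← hp] at hX
        obtain rfl := cF_inj (hpar_ne _) (b2.trans a2.symm) hX
        obtain ⟨a, b, rfl, hadj, hab⟩ := edge_sorted G ord hord e he
        obtain ⟨c, d, rfl, hadj', hcd⟩ := edge_sorted G ord hord f hf
        rw [chord_mk] at hq hq'
        have hm := chords_meet (a := ord a) (b := ord b) (c := ord c) (d := ord d)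
          (by exact_mod_cast hab) (by exact_mod_cast hcd)
          (by exact_mod_cast hpage a b c d hadj hadj' hp hab hcd)
          (by exact_mod_cast hpage c d a b hadj' hadj hp.symm hcd hab)
          (by
            rintro ⟨h1, h2⟩
            apply hef
            rw [hord (Nat.cast_injective h1), hord (Nat.cast_injective h2)]) hq hq'
        rcases hm with ⟨rfl, h⟩ | ⟨rfl, h⟩
        · refine ⟨c, ⟨?_, by simp⟩, (cF_cP _ _).symm⟩
          rcases h with h | h
          · rw [hord (Nat.cast_injective h)]; simp
          · rw [hord (Nat.cast_injective h)]; simp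
        · refine ⟨d, ⟨?_, by simp⟩, (cF_cP _ _).symm⟩
          rcases h with h | h
          · rw [hord (Nat.cast_injective h)]; simp
          · rw [hord (Nat.cast_injective h)]; simp
      · have hz := cF_cross (hpar_ne _) (hpar_ne _)
          (fun h => hp (Fin.ext (hpar_inj h))) a1 b1 hX.symm
        obtain ⟨w, hw, rfl⟩ := a3 (cF_z (hpar_ne _) hz)
        rw [← hX] at hz
        obtain ⟨w', hw', rfl⟩ := b3 (cF_z (hpar_ne _) hz)
        rw [cF_cP, cF_cP] at hX
        obtain rfl := pinj hX
        exact ⟨w', ⟨hw, hw'⟩, (cF_cP _ _).symm⟩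
    · rintro _ ⟨w, ⟨hw, hw'⟩, rfl⟩
      exact ⟨endp e w hw, endp f w hw'⟩
  · rintro e he w ⟨q, hq, hX⟩
    obtain ⟨a1, a2, a3⟩ := chord_props ord e hq
    have hz : cF (hpar (page e)) q 2 = 0 := by rw [hX]; rfl
    obtain ⟨w', hw', rfl⟩ := a3 (cF_z (hpar_ne _) hz)
    rw [cF_cP] at hX
    obtain rfl := pinj hX
    exact hw'
  · intro S hS
    obtain ⟨i, -, rfl⟩ := Finset.mem_image.1 hS
    exact cS_isSphere _
  · exact Finset.card_image_le.trans (by simp)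
  · rintro e he _ ⟨q, hq, rfl⟩
    have hs := cF_sphere (hpar_ne (page e)) q
    rw [hpar_m] at hs
    refine Set.mem_iUnion₂.2 ⟨_, Finset.mem_image.2 ⟨(page e : ℕ) / 2, ?_, rfl⟩, hs⟩
    have := (page e).2
    rw [Finset.mem_range]
    omega
end
end
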